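/- arXiv:1510.05289 — 8 statements merged into one kernel-verified Lean document; each statement's English description precedes it below -/
import Mathlib

section
/- For the uniformized discrete-time chain with transition matrix P, for all j1 with 1 ≤ j1 ≤ Q1, all j2 with 1 ≤ j2 ≤ Q2 and all k ≥ 0: the k-step transition probability (P^k)_{(Q1,Q2),(j1,j2)} equals C(k, Q1−j1)·(λ1/s)^{Q1−j1}·(λ2/s)^{Q2−j2} if k = Q1−j1+Q2−j2, and equals 0 otherwise, where C(·,·) denotes the binomial coefficient. -/
open scoped BigOperators

/-- Generator matrix `Q⁽¹⁾` of the lost-sales two-product inventory chain on the state space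
`{0,…,Q1} × {0,…,Q2}`, with demand rates `l1, l2` and lone-product sales rates `s1, s2`. -/
noncomputable def invGen (Q1 Q2 : ℕ) (l1 l2 s1 s2 : ℝ) :
    Matrix (Fin (Q1 + 1) × Fin (Q2 + 1)) (Fin (Q1 + 1) × Fin (Q2 + 1)) ℝ :=
  fun i j =>
    if 1 ≤ (i.1 : ℕ) ∧ 1 ≤ (i.2 : ℕ) then
      (if (j.1 : ℕ) = (i.1 : ℕ) - 1 ∧ (j.2 : ℕ) = (i.2 : ℕ) then l1 else 0) +
      (if (j.1 : ℕ) = (i.1 : ℕ) ∧ (j.2 : ℕ) = (i.2 : ℕ) - 1 then l2 else 0) +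
      (if j = i then -(l1 + l2) else 0)
    else if 1 ≤ (i.1 : ℕ) ∧ (i.2 : ℕ) = 0 then
      (if (j.1 : ℕ) = (i.1 : ℕ) - 1 ∧ (j.2 : ℕ) = 0 then s1 else 0) +
      (if j = i then -s1 else 0)
    else if (i.1 : ℕ) = 0 ∧ 1 ≤ (i.2 : ℕ) then
      (if (j.1 : ℕ) = 0 ∧ (j.2 : ℕ) = (i.2 : ℕ) - 1 then s2 else 0) +
      (if j = i then -s2 else 0)
    else 0

/-- The columns of the uniformized matrix at interior states. -/
lemma unif_col (Q1 Q2 : ℕ) (l1 l2 s1 s2 : ℝ) (hs : l1 + l2 ≠ 0)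
    (m j : Fin (Q1 + 1) × Fin (Q2 + 1)) (h1 : 1 ≤ (j.1 : ℕ)) (h2 : 1 ≤ (j.2 : ℕ)) :
    (1 + (l1 + l2)⁻¹ • invGen Q1 Q2 l1 l2 s1 s2) m j =
      (if (m.1 : ℕ) = j.1 + 1 ∧ (m.2 : ℕ) = j.2 then l1 / (l1 + l2) else 0) +
      (if (m.1 : ℕ) = j.1 ∧ (m.2 : ℕ) = j.2 + 1 then l2 / (l1 + l2) else 0) := by
  obtain ⟨⟨m1, hm1⟩, ⟨m2, hm2⟩⟩ := m
  obtain ⟨⟨j1, hj1⟩, ⟨j2, hj2⟩⟩ := j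
  simp only [Matrix.add_apply, Matrix.smul_apply, smul_eq_mul, invGen, Matrix.one_apply,
    Prod.mk.injEq, Fin.mk.injEq] at *
  by_cases hm : 1 ≤ m1 ∧ 1 ≤ m2
  · have e1 : (j1 = m1 - 1 ∧ j2 = m2) ↔ (m1 = j1 + 1 ∧ m2 = j2) := by omega
    have e2 : (j1 = m1 ∧ j2 = m2 - 1) ↔ (m1 = j1 ∧ m2 = j2 + 1) := by omega
    have e3 : (j1 = m1 ∧ j2 = m2) ↔ (m1 = j1 ∧ m2 = j2) := by omega
    rw [if_pos hm]
    simp only [e1, e2, e3]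
    split_ifs <;> first | omega | (field_simp; try ring)
  · have n0 : ¬ (m1 = j1 ∧ m2 = j2) := by omega
    have n0' : ¬ (j1 = m1 ∧ j2 = m2) := by omega
    have n1 : ¬ (m1 = j1 + 1 ∧ m2 = j2) := by omega
    have n2 : ¬ (m1 = j1 ∧ m2 = j2 + 1) := by omega
    have n3 : ¬ (j1 = m1 - 1 ∧ j2 = 0) := by omega
    have n4 : ¬ (j1 = 0 ∧ j2 = m2 - 1) := by omega
    rw [if_neg hm, if_neg n0, if_neg n0', if_neg n1, if_neg n2, if_neg n3, if_neg n4]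
    simp only [if_neg n0', add_zero, ite_self, mul_zero]

/-- Summing against the indicator of a single state. -/
lemma sum_single_state (A B : ℕ) (f : Fin (A + 1) × Fin (B + 1) → ℝ) (a b : ℕ) (c : ℝ) :
    ∑ m, f m * (if (m.1 : ℕ) = a ∧ (m.2 : ℕ) = b then c else 0) =
      if h : a < A + 1 ∧ b < B + 1 then f (⟨a, h.1⟩, ⟨b, h.2⟩) * c else 0 := by
  split_ifs with h
  · rw [Finset.sum_eq_single (⟨a, h.1⟩, ⟨b, h.2⟩)]
    · simp
    · rintro ⟨⟨x, hx⟩, ⟨y, hy⟩⟩ - hne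
      simp only [ne_eq, Prod.mk.injEq, Fin.mk.injEq] at hne
      simp [hne]
    · simp
  · apply Finset.sum_eq_zero
    rintro ⟨⟨x, hx⟩, ⟨y, hy⟩⟩ -
    have : ¬ (x = a ∧ y = b) := by omega
    simp [this]

/-- k-step transition probabilities of the uniformized chain: interior target states. -/
theorem uniformized_kstep_interior (Q1 Q2 : ℕ) (hQ1 : 1 ≤ Q1) (hQ2 : 1 ≤ Q2)
    (lam1 lam2 p12 p21 : ℝ) (hl1 : 0 < lam1) (hl2 : 0 < lam2)
    (hp12 : p12 ∈ Set.Icc (0 : ℝ) 1) (hp21 : p21 ∈ Set.Icc (0 : ℝ) 1)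
    (j1 j2 : ℕ) (hj1l : 1 ≤ j1) (hj1u : j1 ≤ Q1) (hj2l : 1 ≤ j2) (hj2u : j2 ≤ Q2) (k : ℕ) :
    ((1 + (lam1 + lam2)⁻¹ •
        invGen Q1 Q2 lam1 lam2 (lam1 + lam2 * p21) (lam2 + lam1 * p12)) ^ k)
      (⟨Q1, by omega⟩, ⟨Q2, by omega⟩) (⟨j1, by omega⟩, ⟨j2, by omega⟩) =
      if k = (Q1 - j1) + (Q2 - j2) then
        (Nat.choose k (Q1 - j1) : ℝ) * (lam1 / (lam1 + lam2)) ^ (Q1 - j1) *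
          (lam2 / (lam1 + lam2)) ^ (Q2 - j2)
      else 0 := by
  have hs : lam1 + lam2 ≠ 0 := by positivity
  induction k generalizing j1 j2 with
  | zero =>
    simp only [pow_zero, Matrix.one_apply, Prod.mk.injEq, Fin.mk.injEq]
    by_cases h : Q1 = j1 ∧ Q2 = j2
    · obtain ⟨rfl, rfl⟩ := h
      simp
    · rw [if_neg h, if_neg (by omega)]
  | succ k ih =>
    rw [pow_succ, Matrix.mul_apply]
    have hc := fun m => unif_col Q1 Q2 lam1 lam2 (lam1 + lam2 * p21) (lam2 + lam1 * p12) hs m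
      (⟨j1, by omega⟩, ⟨j2, by omega⟩) hj1l hj2l
    simp only [hc, mul_add, Finset.sum_add_distrib, sum_single_state]
    obtain ⟨a, rfl⟩ := Nat.exists_eq_add_of_le hj1u
    obtain ⟨b, rfl⟩ := Nat.exists_eq_add_of_le hj2u
    generalize lam1 / (lam1 + lam2) = x at *
    generalize lam2 / (lam1 + lam2) = y at *
    have i1 := ih (j1 + 1) j2 (by omega)
    have i2 := ih j1 (j2 + 1) hj1l
    rcases a with _ | a
    · rcases b with _ | b
      · rw [dif_neg (by omega), dif_neg (by omega), if_neg (by omega)]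
        simp
      · rw [dif_neg (by omega), dif_pos (by omega), i2 (by omega) (by omega) (by omega)]
        have e : j2 + (b + 1) - (j2 + 1) = b := by omega
        simp only [e, Nat.add_sub_cancel_left]
        by_cases hk : k = b
        · subst hk
          simp [pow_succ]
        · rw [if_neg (by omega), if_neg (by omega)]
          simp
    · have e1 : j1 + (a + 1) - (j1 + 1) = a := by omega
      rcases b with _ | b
      · rw [dif_pos (by omega), dif_neg (by omega), i1 (by omega) (by omega) (by omega)]
        simp only [e1, Nat.add_sub_cancel_left]
        by_cases hk : k = a
        · subst hk
          simp [pow_succ]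
        · rw [if_neg (by omega), if_neg (by omega)]
          simp
      · have e : j2 + (b + 1) - (j2 + 1) = b := by omega
        rw [dif_pos (by omega), dif_pos (by omega), i1 (by omega) (by omega) (by omega),
          i2 (by omega) (by omega) (by omega)]
        simp only [e1, e, Nat.add_sub_cancel_left]
        by_cases hk : k = a + b + 1
        · rw [if_pos (by omega), if_pos (by omega), if_pos (by omega), Nat.choose_succ_succ]
          push_cast
          ring
        · rw [if_neg (by omega), if_neg (by omega), if_neg (by omega)]
          simp
end

section
/- For the uniformized discrete-time chain with transition matrix P, for all j1 with 1 ≤ j1 ≤ Q1 and all k ≥ 0: if k ≥ Q1−j1+Q2 then (P^k)_{(Q1,Q2),(j1,0)} = Σ_{l=Q2}^{Q2+Q1−j1} C(l−1, Q2−1)·(λ2/s)^{Q2}·(λ1/s)^{l−Q2}·C(k−l, Q1+Q2−j1−l)·(s1/s)^{Q1+Q2−j1−l}·((s−s1)/s)^{k−Q1−Q2+j1}, and if k < Q1−j1+Q2 then (P^k)_{(Q1,Q2),(j1,0)} = 0, where C(·,·) denotes the binomial coefficient. -/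
open scoped BigOperators

/-- boundary row: k-step probability of `m` net downward moves -/
noncomputable def bdH (c d : ℝ) (k m : ℕ) : ℝ := (Nat.choose k m : ℝ) * c ^ m * d ^ (k - m)

lemma bdH_zero_succ (c d : ℝ) (m : ℕ) : bdH c d 0 (m + 1) = 0 := by simp [bdH]

lemma bdH_succ_zero (c d : ℝ) (k : ℕ) : bdH c d (k + 1) 0 = d * bdH c d k 0 := by
  simp [bdH, pow_succ, mul_comm]

lemma bdH_succ_succ (c d : ℝ) (k m : ℕ) :
    bdH c d (k + 1) (m + 1) = c * bdH c d k m + d * bdH c d k (m + 1) := by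
  unfold bdH
  rw [Nat.choose_succ_succ]
  rcases Nat.lt_or_ge k (m + 1) with h | h
  · have h0 : Nat.choose k (m + 1) = 0 := Nat.choose_eq_zero_of_lt h
    rw [h0]
    simp
    ring
  · obtain ⟨e, rfl⟩ := Nat.exists_eq_add_of_le h
    have e1 : m + 1 + e + 1 - (m + 1) = e + 1 := by omega
    have e2 : m + 1 + e - m = e + 1 := by omega
    have e3 : m + 1 + e - (m + 1) = e := by omega
    rw [e1, e2, e3]
    push_cast
    ring

/-- k-step probability of moving `m` down in product 1 and `n` (to zero) in product 2 -/
noncomputable def bdG (a b c d : ℝ) (k m : ℕ) : ℕ → ℝ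
  | 0 => bdH c d k m
  | n + 1 => ∑ r ∈ Finset.range (m + 1), if n + 1 + r ≤ k then
      (Nat.choose (n + r) n : ℝ) * b ^ (n + 1) * a ^ r * bdH c d (k - (n + 1 + r)) (m - r) else 0

lemma bdG_zero_succ (a b c d : ℝ) (m n : ℕ) : bdG a b c d 0 m (n + 1) = 0 := by
  unfold bdG
  apply Finset.sum_eq_zero
  intro r _
  rw [if_neg (by omega)]

lemma bdG_rec_zero (a b c d : ℝ) (k n : ℕ) :
    bdG a b c d (k + 1) 0 (n + 1) = b * bdG a b c d k 0 n := by
  cases n with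
  | zero => simp [bdG]
  | succ n =>
    simp only [bdG, zero_add, Finset.sum_range_one, add_zero, Nat.choose_self]
    by_cases h : n + 1 ≤ k
    · rw [if_pos h, if_pos (by omega), show k + 1 - (n + 1 + 1) = k - (n + 1) by omega]
      ring
    · rw [if_neg h, if_neg (by omega)]
      simp

lemma bdG_rec_succ (a b c d : ℝ) (k m n : ℕ) :
    bdG a b c d (k + 1) (m + 1) (n + 1) =
      a * bdG a b c d k m (n + 1) + b * bdG a b c d k (m + 1) n := by
  cases n with
  | zero =>
    simp only [bdG]
    rw [Finset.sum_range_succ', Finset.mul_sum]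
    congr 1
    · apply Finset.sum_congr rfl
      intro r _
      by_cases h : 0 + 1 + r ≤ k
      · rw [if_pos h, if_pos (by omega),
          show k + 1 - (0 + 1 + (r + 1)) = k - (0 + 1 + r) by omega,
          show m + 1 - (r + 1) = m - r by omega]
        simp
        ring
      · rw [if_neg h, if_neg (by omega)]
        simp
    · simp
  | succ n =>
    simp only [bdG]
    rw [Finset.sum_range_succ' _ (m + 1), Finset.sum_range_succ' _ (m + 1), mul_add,
      Finset.mul_sum, Finset.mul_sum, ← add_assoc, ← Finset.sum_add_distrib]
    congr 1
    · apply Finset.sum_congr rfl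
      intro r _
      by_cases h : n + 1 + 1 + r ≤ k
      · rw [if_pos h, if_pos (by omega), if_pos (by omega),
          show k + 1 - (n + 1 + 1 + (r + 1)) = k - (n + 1 + 1 + r) by omega,
          show k - (n + 1 + (r + 1)) = k - (n + 1 + 1 + r) by omega,
          show m + 1 - (r + 1) = m - r by omega,
          show n + 1 + (r + 1) = (n + (r + 1)) + 1 by omega, Nat.choose_succ_succ,
          show n + 1 + r = n + (r + 1) by omega]
        push_cast
        ring
      · rw [if_neg h, if_neg (by omega), if_neg (by omega)]
        simp
    · simp only [add_zero, Nat.choose_self]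
      by_cases h : n + 1 ≤ k
      · rw [if_pos h, if_pos (by omega), show k + 1 - (n + 1 + 1) = k - (n + 1) by omega]
        ring
      · rw [if_neg h, if_neg (by omega)]
        simp

lemma invGen_row_int (Q1 Q2 : ℕ) (l1 l2 s1 s2 : ℝ) (hs : l1 + l2 ≠ 0) (G : ℕ → ℕ → ℝ)
    (i1 i2 : ℕ) (h1 : i1 + 1 < Q1 + 1) (h2 : i2 + 1 < Q2 + 1) :
    ∑ y : Fin (Q1 + 1) × Fin (Q2 + 1),
      (1 + (l1 + l2)⁻¹ • invGen Q1 Q2 l1 l2 s1 s2) (⟨i1 + 1, h1⟩, ⟨i2 + 1, h2⟩) y * G y.1 y.2 =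
      l1 / (l1 + l2) * G i1 (i2 + 1) + l2 / (l1 + l2) * G (i1 + 1) i2 := by
  have key : ∀ y : Fin (Q1 + 1) × Fin (Q2 + 1),
      (1 + (l1 + l2)⁻¹ • invGen Q1 Q2 l1 l2 s1 s2) (⟨i1 + 1, h1⟩, ⟨i2 + 1, h2⟩) y * G y.1 y.2 =
      (if y = (⟨i1, by omega⟩, ⟨i2 + 1, h2⟩) then l1 / (l1 + l2) * G y.1 y.2 else 0) +
      (if y = (⟨i1 + 1, h1⟩, ⟨i2, by omega⟩) then l2 / (l1 + l2) * G y.1 y.2 else 0) := by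
    rintro ⟨⟨y1, hy1⟩, ⟨y2, hy2⟩⟩
    simp only [Matrix.add_apply, Matrix.smul_apply, Matrix.one_apply, invGen, Prod.mk.injEq,
      Fin.mk.injEq, smul_eq_mul, Nat.add_sub_cancel]
    rw [if_pos (by omega : 1 ≤ i1 + 1 ∧ 1 ≤ i2 + 1)]
    split_ifs <;> first | omega | (field_simp; ring_nf) | (field_simp)
  rw [Finset.sum_congr rfl (fun y _ => key y), Finset.sum_add_distrib]
  simp

lemma invGen_row_bd (Q1 Q2 : ℕ) (l1 l2 s1 s2 : ℝ) (hs : l1 + l2 ≠ 0) (G : ℕ → ℕ → ℝ)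
    (i1 : ℕ) (h1 : i1 + 1 < Q1 + 1) (h2 : 0 < Q2 + 1) :
    ∑ y : Fin (Q1 + 1) × Fin (Q2 + 1),
      (1 + (l1 + l2)⁻¹ • invGen Q1 Q2 l1 l2 s1 s2) (⟨i1 + 1, h1⟩, ⟨0, h2⟩) y * G y.1 y.2 =
      s1 / (l1 + l2) * G i1 0 + ((l1 + l2) - s1) / (l1 + l2) * G (i1 + 1) 0 := by
  have key : ∀ y : Fin (Q1 + 1) × Fin (Q2 + 1),
      (1 + (l1 + l2)⁻¹ • invGen Q1 Q2 l1 l2 s1 s2) (⟨i1 + 1, h1⟩, ⟨0, h2⟩) y * G y.1 y.2 =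
      (if y = (⟨i1, by omega⟩, ⟨0, h2⟩) then s1 / (l1 + l2) * G y.1 y.2 else 0) +
      (if y = (⟨i1 + 1, h1⟩, ⟨0, h2⟩) then ((l1 + l2) - s1) / (l1 + l2) * G y.1 y.2 else 0) := by
    rintro ⟨⟨y1, hy1⟩, ⟨y2, hy2⟩⟩
    simp only [Matrix.add_apply, Matrix.smul_apply, Matrix.one_apply, invGen, Prod.mk.injEq,
      Fin.mk.injEq, smul_eq_mul, Nat.add_sub_cancel]
    rw [if_neg (by omega : ¬ (1 ≤ i1 + 1 ∧ 1 ≤ 0)),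
      if_pos (⟨by omega, trivial⟩ : 1 ≤ i1 + 1 ∧ True)]
    split_ifs <;> first | omega | (field_simp; ring_nf) | (field_simp)
  rw [Finset.sum_congr rfl (fun y _ => key y), Finset.sum_add_distrib]
  simp only [Finset.sum_ite_eq', Finset.mem_univ, if_true]

lemma invGen_row_zero (Q1 Q2 : ℕ) (l1 l2 s1 s2 : ℝ) (G : ℕ → ℕ → ℝ) (hG : ∀ i, G 0 i = 0)
    (h1 : 0 < Q1 + 1) (i2 : Fin (Q2 + 1)) :
    ∑ y : Fin (Q1 + 1) × Fin (Q2 + 1),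
      (1 + (l1 + l2)⁻¹ • invGen Q1 Q2 l1 l2 s1 s2) (⟨0, h1⟩, i2) y * G y.1 y.2 = 0 := by
  apply Finset.sum_eq_zero
  rintro ⟨⟨y1, hy1⟩, ⟨y2, hy2⟩⟩ _
  obtain ⟨i2, h2⟩ := i2
  rcases Nat.eq_zero_or_pos y1 with h | h
  · subst h
    simp [hG]
  · simp only [Matrix.add_apply, Matrix.smul_apply, Matrix.one_apply, invGen, Prod.mk.injEq,
      Fin.mk.injEq, smul_eq_mul]
    split_ifs <;> first | omega | simp

lemma kstep_eq (Q1 Q2 : ℕ) (l1 l2 s1 s2 : ℝ) (hs : l1 + l2 ≠ 0)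
    (j1 : ℕ) (hj : 1 ≤ j1) (hj1 : j1 < Q1 + 1) (k : ℕ) :
    ∀ i : Fin (Q1 + 1) × Fin (Q2 + 1),
    ((1 + (l1 + l2)⁻¹ • invGen Q1 Q2 l1 l2 s1 s2) ^ k) i (⟨j1, hj1⟩, ⟨0, by omega⟩) =
      if (i.1 : ℕ) < j1 then 0 else
        bdG (l1 / (l1 + l2)) (l2 / (l1 + l2)) (s1 / (l1 + l2)) (((l1 + l2) - s1) / (l1 + l2))
          k (i.1 - j1) i.2 := by
  induction k with
  | zero =>
    rintro ⟨⟨i1, h1⟩, ⟨i2, h2⟩⟩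
    simp only [pow_zero, Matrix.one_apply, Prod.mk.injEq, Fin.mk.injEq]
    by_cases hlt : i1 < j1
    · rw [if_pos hlt, if_neg (by omega)]
    · rw [if_neg hlt]
      cases i2 with
      | succ n => rw [bdG_zero_succ, if_neg (by omega)]
      | zero =>
        by_cases he : i1 = j1
        · subst he
          simp [bdG, bdH]
        · rw [if_neg (by omega)]
          obtain ⟨e, rfl⟩ := Nat.exists_eq_add_of_le (show j1 + 1 ≤ i1 by omega)
          rw [show j1 + 1 + e - j1 = e + 1 by omega]
          simp [bdG, bdH]
  | succ k ih =>
    intro i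
    rw [pow_succ', Matrix.mul_apply, Finset.sum_congr rfl (fun y _ => by rw [ih y])]
    set a := l1 / (l1 + l2) with ha
    set b := l2 / (l1 + l2) with hb
    set c := s1 / (l1 + l2) with hc
    set d := ((l1 + l2) - s1) / (l1 + l2) with hd
    let G : ℕ → ℕ → ℝ := fun x y => if x < j1 then 0 else bdG a b c d k (x - j1) y
    obtain ⟨⟨i1, h1⟩, ⟨i2, h2⟩⟩ := i
    cases i1 with
    | zero =>
      refine (invGen_row_zero Q1 Q2 l1 l2 s1 s2 G ?_ h1 ⟨i2, h2⟩).trans ?_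
      · intro i
        simp only [G]
        rw [if_pos (by omega)]
      · simp only
        rw [if_pos (by omega)]
    | succ i1 =>
      cases i2 with
      | zero =>
        refine (invGen_row_bd Q1 Q2 l1 l2 s1 s2 hs G i1 h1 h2).trans ?_
        simp only [G, ← hc, ← hd]
        rcases lt_trichotomy (i1 + 1) j1 with h | h | h
        · rw [if_pos (by omega), if_pos h, if_pos h]
          simp
        · subst h
          simp [bdG, bdH_succ_zero]
        · rw [if_neg (by omega), if_neg (by omega), if_neg (by omega),
            show i1 + 1 - j1 = (i1 - j1) + 1 by omega]
          simp only [bdG, bdH_succ_succ]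
      | succ n =>
        refine (invGen_row_int Q1 Q2 l1 l2 s1 s2 hs G i1 n h1 h2).trans ?_
        simp only [G, ← ha, ← hb]
        rcases lt_trichotomy (i1 + 1) j1 with h | h | h
        · rw [if_pos (by omega), if_pos h, if_pos h]
          simp
        · subst h
          simp [bdG_rec_zero]
        · rw [if_neg (by omega), if_neg (by omega), if_neg (by omega),
            show i1 + 1 - j1 = (i1 - j1) + 1 by omega, bdG_rec_succ]

/-- k-step transition probabilities of the uniformized chain: target states `(j1, 0)`, `j1 ≥ 1`. -/
theorem uniformized_kstep_boundary1 (Q1 Q2 : ℕ) (hQ1 : 1 ≤ Q1) (hQ2 : 1 ≤ Q2)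
    (lam1 lam2 p12 p21 : ℝ) (hl1 : 0 < lam1) (hl2 : 0 < lam2)
    (hp12 : p12 ∈ Set.Icc (0 : ℝ) 1) (hp21 : p21 ∈ Set.Icc (0 : ℝ) 1)
    (j1 : ℕ) (hj1l : 1 ≤ j1) (hj1u : j1 ≤ Q1) (k : ℕ) :
    ((1 + (lam1 + lam2)⁻¹ •
        invGen Q1 Q2 lam1 lam2 (lam1 + lam2 * p21) (lam2 + lam1 * p12)) ^ k)
      (⟨Q1, by omega⟩, ⟨Q2, by omega⟩) (⟨j1, by omega⟩, ⟨0, by omega⟩) =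
      if Q1 - j1 + Q2 ≤ k then
        ∑ l ∈ Finset.Icc Q2 (Q2 + Q1 - j1),
          (Nat.choose (l - 1) (Q2 - 1) : ℝ) * (lam2 / (lam1 + lam2)) ^ Q2 *
            (lam1 / (lam1 + lam2)) ^ (l - Q2) *
          (Nat.choose (k - l) (Q1 + Q2 - j1 - l) : ℝ) *
            ((lam1 + lam2 * p21) / (lam1 + lam2)) ^ (Q1 + Q2 - j1 - l) *
            (((lam1 + lam2) - (lam1 + lam2 * p21)) / (lam1 + lam2)) ^ (k - (Q1 + Q2 - j1))
      else 0 := by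
  rw [kstep_eq Q1 Q2 lam1 lam2 _ _ (by positivity) j1 hj1l (by omega) k]
  simp only
  rw [if_neg (by omega)]
  generalize lam1 / (lam1 + lam2) = a
  generalize lam2 / (lam1 + lam2) = b
  generalize (lam1 + lam2 * p21) / (lam1 + lam2) = c
  generalize (lam1 + lam2 - (lam1 + lam2 * p21)) / (lam1 + lam2) = d
  obtain ⟨m, rfl⟩ := Nat.exists_eq_add_of_le hj1u
  obtain ⟨n, rfl⟩ := Nat.exists_eq_add_of_le' hQ2
  rw [show j1 + m - j1 = m by omega]
  simp only [bdG]
  split_ifs with hk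
  · rw [show n + 1 + (j1 + m) - j1 = n + 1 + m by omega,
      show j1 + m + (n + 1) - j1 = n + 1 + m by omega]
    rw [← Finset.Ico_add_one_right_eq_Icc, Finset.sum_Ico_eq_sum_range,
      show n + 1 + m + 1 - (n + 1) = m + 1 by omega]
    apply Finset.sum_congr rfl
    intro r hr
    have hr' := Finset.mem_range.mp hr
    rw [if_pos (by omega)]
    unfold bdH
    rw [show n + 1 + r - 1 = n + r by omega, show n + 1 - 1 = n by omega,
      show n + 1 + r - (n + 1) = r by omega,
      show n + 1 + m - (n + 1 + r) = m - r by omega,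
      show k - (n + 1 + r) - (m - r) = k - (n + 1 + m) by omega]
    ring
  · apply Finset.sum_eq_zero
    intro r hr
    have hr' := Finset.mem_range.mp hr
    split_ifs with h
    · unfold bdH
      rw [Nat.choose_eq_zero_of_lt (by omega : k - (n + 1 + r) < m - r)]
      simp
    · rfl
end

section
/- For the uniformized discrete-time chain with transition matrix P, for all j2 with 1 ≤ j2 ≤ Q2 and all k ≥ 0: if k ≥ Q1+Q2−j2 then (P^k)_{(Q1,Q2),(0,j2)} = Σ_{l=Q1}^{Q1+Q2−j2} C(l−1, Q1−1)·(λ1/s)^{Q1}·(λ2/s)^{l−Q1}·C(k−l, Q1+Q2−j2−l)·(s2/s)^{Q1+Q2−j2−l}·((s−s2)/s)^{k−Q1−Q2+j2}, and if k < Q1+Q2−j2 then (P^k)_{(Q1,Q2),(0,j2)} = 0, where C(·,·) denotes the binomial coefficient. -/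
open scoped BigOperators

/-- Closed form in shifted coordinates. -/
noncomputable def kstepH (x y q r : ℝ) (k a d : ℕ) : ℝ :=
  if a + d ≤ k then
    ∑ m ∈ Finset.range (d + 1), (Nat.multichoose a m : ℝ) * x ^ a * y ^ m *
      (Nat.choose (k - (a + m)) (d - m) : ℝ) * q ^ (d - m) * r ^ (k - (a + d))
  else 0

theorem kstepH_zero_left (x y q r : ℝ) (k d : ℕ) :
    kstepH x y q r k 0 d = (Nat.choose k d : ℝ) * q ^ d * r ^ (k - d) := by
  unfold kstepH
  split_ifs with h
  · rw [Finset.sum_range_succ']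
    simp [Nat.multichoose_zero_succ]
  · rw [Nat.choose_eq_zero_of_lt (by omega)]; simp

theorem kstepH_time_zero (x y q r : ℝ) (a d : ℕ) :
    kstepH x y q r 0 a d = if a = 0 ∧ d = 0 then 1 else 0 := by
  unfold kstepH
  by_cases h : a = 0 ∧ d = 0
  · obtain ⟨rfl, rfl⟩ := h; simp
  · rw [if_neg h, if_neg (by omega)]

theorem kstepH_bd_zero (x y q r : ℝ) (k : ℕ) :
    kstepH x y q r (k + 1) 0 0 = r * kstepH x y q r k 0 0 := by
  simp [kstepH_zero_left, pow_succ']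

theorem kstepH_bd_succ (x y q r : ℝ) (k d : ℕ) :
    kstepH x y q r (k + 1) 0 (d + 1) =
      q * kstepH x y q r k 0 d + r * kstepH x y q r k 0 (d + 1) := by
  simp only [kstepH_zero_left, Nat.choose_succ_succ, Nat.cast_add, Nat.succ_eq_add_one,
    Nat.add_sub_add_right]
  rcases lt_or_ge k (d + 1) with h | h
  · rw [Nat.choose_eq_zero_of_lt h]; simp; ring
  · obtain ⟨e, rfl⟩ := Nat.exists_eq_add_of_le h
    rw [show d + 1 + e - d = e + 1 by omega, show d + 1 + e - (d + 1) = e by omega]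
    ring

theorem kstepH_int_zero (x y q r : ℝ) (k a : ℕ) :
    kstepH x y q r (k + 1) (a + 1) 0 = x * kstepH x y q r k a 0 := by
  unfold kstepH
  by_cases h : a ≤ k
  · simp [h, pow_succ']; ring
  · simp [h]

theorem kstepH_int_succ (x y q r : ℝ) (k a d : ℕ) :
    kstepH x y q r (k + 1) (a + 1) (d + 1) =
      x * kstepH x y q r k a (d + 1) + y * kstepH x y q r k (a + 1) d := by
  unfold kstepH
  by_cases h : a + (d + 1) ≤ k
  · rw [if_pos (by omega), if_pos h, if_pos (by omega), Finset.sum_range_succ',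
      Finset.sum_range_succ' _ (d + 1), mul_add, Finset.mul_sum, Finset.mul_sum,
      add_right_comm (Finset.sum _ _) (x * _), ← Finset.sum_add_distrib]
    congr 1
    · refine Finset.sum_congr rfl fun m _ => ?_
      rw [Nat.multichoose_succ_succ,
        show k + 1 - (a + 1 + (m + 1)) = k - (a + (m + 1)) by omega,
        show k - (a + 1 + m) = k - (a + (m + 1)) by omega,
        show d + 1 - (m + 1) = d - m by omega,
        show k + 1 - (a + 1 + (d + 1)) = k - (a + (d + 1)) by omega,
        show k - (a + 1 + d) = k - (a + (d + 1)) by omega]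
      push_cast
      ring
    · rw [show k + 1 - (a + 1 + (d + 1)) = k - (a + (d + 1)) by omega,
        show k + 1 - (a + 1 + 0) = k - (a + 0) by omega]
      simp only [Nat.multichoose_zero_right]
      ring
  · rw [if_neg (by omega), if_neg h, if_neg (by omega)]; ring

/-- One step of the chain applied to a function. -/
theorem invStep_sum (Q1 Q2 : ℕ) (l1 l2 s1 s2 c : ℝ) (hc : c * (l1 + l2) = 1)
    (v : Fin (Q1 + 1) × Fin (Q2 + 1) → ℝ) :
    (∀ (a b : ℕ) (ha : a + 1 < Q1 + 1) (hb : b + 1 < Q2 + 1),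
      ∑ j, (1 + c • invGen Q1 Q2 l1 l2 s1 s2) (⟨a + 1, ha⟩, ⟨b + 1, hb⟩) j * v j =
        c * l1 * v (⟨a, by omega⟩, ⟨b + 1, hb⟩) + c * l2 * v (⟨a + 1, ha⟩, ⟨b, by omega⟩)) ∧
    (∀ (a : ℕ) (ha : a + 1 < Q1 + 1),
      ∑ j, (1 + c • invGen Q1 Q2 l1 l2 s1 s2) (⟨a + 1, ha⟩, ⟨0, by omega⟩) j * v j =
        c * s1 * v (⟨a, by omega⟩, ⟨0, by omega⟩)
          + (1 - c * s1) * v (⟨a + 1, ha⟩, ⟨0, by omega⟩)) ∧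
    (∀ (b : ℕ) (hb : b + 1 < Q2 + 1),
      ∑ j, (1 + c • invGen Q1 Q2 l1 l2 s1 s2) (⟨0, by omega⟩, ⟨b + 1, hb⟩) j * v j =
        c * s2 * v (⟨0, by omega⟩, ⟨b, by omega⟩)
          + (1 - c * s2) * v (⟨0, by omega⟩, ⟨b + 1, hb⟩)) ∧
    ∑ j, (1 + c • invGen Q1 Q2 l1 l2 s1 s2) (⟨0, by omega⟩, ⟨0, by omega⟩) j * v j =
      v (⟨0, by omega⟩, ⟨0, by omega⟩) := by
  have key : ∀ (i0 i1 i2 : Fin (Q1 + 1) × Fin (Q2 + 1)) (w0 w1 w2 : ℝ),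
      ∑ j, ((if j = i0 then w0 else 0) + (if j = i1 then w1 else 0)
        + (if j = i2 then w2 else 0)) * v j = w0 * v i0 + w1 * v i1 + w2 * v i2 := by
    intro i0 i1 i2 w0 w1 w2
    simp [add_mul, Finset.sum_add_distrib, ite_mul]
  refine ⟨fun a b ha hb => ?_, fun a ha => ?_, fun b hb => ?_, ?_⟩
  · rw [← add_zero (c * l1 * _ + _), ← zero_mul (v (⟨a + 1, ha⟩, ⟨b + 1, hb⟩)), ← key]
    refine Finset.sum_congr rfl fun j _ => ?_
    congr 1
    obtain ⟨⟨j1, h1⟩, ⟨j2, h2⟩⟩ := j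
    simp only [Matrix.add_apply, Matrix.smul_apply, Matrix.one_apply, invGen, Prod.mk.injEq,
      Fin.mk.injEq, smul_eq_mul]
    split_ifs <;> first | omega | linarith | (exfalso; clear key; have hN : ∀ n : ℕ, 1 ≤ n + 1 := (fun n => by omega); have := hN; simp only [true_and, and_true] at *; omega)
  · rw [← add_zero (c * s1 * _ + _), ← zero_mul (v (⟨a + 1, ha⟩, ⟨0, by omega⟩)), ← key]
    refine Finset.sum_congr rfl fun j _ => ?_
    congr 1
    obtain ⟨⟨j1, h1⟩, ⟨j2, h2⟩⟩ := j
    simp only [Matrix.add_apply, Matrix.smul_apply, Matrix.one_apply, invGen, Prod.mk.injEq,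
      Fin.mk.injEq, smul_eq_mul]
    split_ifs <;> first | omega | linarith | (exfalso; clear key; have hN : ∀ n : ℕ, 1 ≤ n + 1 := (fun n => by omega); have := hN; simp only [true_and, and_true] at *; omega)
  · rw [← add_zero (c * s2 * _ + _), ← zero_mul (v (⟨0, by omega⟩, ⟨b + 1, hb⟩)), ← key]
    refine Finset.sum_congr rfl fun j _ => ?_
    congr 1
    obtain ⟨⟨j1, h1⟩, ⟨j2, h2⟩⟩ := j
    simp only [Matrix.add_apply, Matrix.smul_apply, Matrix.one_apply, invGen, Prod.mk.injEq,
      Fin.mk.injEq, smul_eq_mul]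
    split_ifs <;> first | omega | linarith | (exfalso; clear key; have hN : ∀ n : ℕ, 1 ≤ n + 1 := (fun n => by omega); have := hN; simp only [true_and, and_true] at *; omega)
  · simp [Matrix.add_apply, Matrix.smul_apply, Matrix.one_apply, invGen]

theorem invPow_eq (Q1 Q2 : ℕ) (l1 l2 s1 s2 c : ℝ) (hc : c * (l1 + l2) = 1)
    (j : ℕ) (hj1 : 1 ≤ j) (hj : j < Q2 + 1) (k : ℕ) :
    ∀ (a b : ℕ) (ha : a < Q1 + 1) (hb : b < Q2 + 1),
      ((1 + c • invGen Q1 Q2 l1 l2 s1 s2) ^ k) (⟨a, ha⟩, ⟨b, hb⟩) (⟨0, by omega⟩, ⟨j, hj⟩) =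
        if j ≤ b then kstepH (c * l1) (c * l2) (c * s2) (1 - c * s2) k a (b - j) else 0 := by
  induction k with
  | zero =>
    intro a b ha hb
    simp only [pow_zero, Matrix.one_apply, kstepH_time_zero, Prod.mk.injEq, Fin.mk.injEq]
    split_ifs <;> first | omega | rfl
  | succ k ih =>
    intro a b ha hb
    obtain ⟨h1, h2, h3, h4⟩ := invStep_sum Q1 Q2 l1 l2 s1 s2 c hc
      (fun i => ((1 + c • invGen Q1 Q2 l1 l2 s1 s2) ^ k) i (⟨0, by omega⟩, ⟨j, hj⟩))
    rw [pow_succ', Matrix.mul_apply]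
    rcases a with _ | a <;> rcases b with _ | b
    · rw [h4, ih, if_neg (by omega), if_neg (by omega)]
    · rw [h3, ih, ih]
      rcases lt_trichotomy j (b + 1) with h | h | h
      · rw [if_pos (by omega), if_pos (by omega), if_pos (by omega),
          show b + 1 - j = b - j + 1 by omega, kstepH_bd_succ]
      · rw [if_neg (by omega), if_pos (by omega), if_pos (by omega), h, Nat.sub_self,
          kstepH_bd_zero]
        ring
      · rw [if_neg (by omega), if_neg (by omega), if_neg (by omega)]
        ring
    · rw [h2, ih, ih]
      simp only [show ¬ j ≤ 0 by omega, if_false]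
      ring
    · rw [h1, ih, ih]
      rcases lt_trichotomy j (b + 1) with h | h | h
      · rw [if_pos (by omega), if_pos (by omega), if_pos (by omega),
          show b + 1 - j = b - j + 1 by omega, kstepH_int_succ]
      · rw [if_pos (by omega), if_neg (by omega), if_pos (by omega), h, Nat.sub_self,
          kstepH_int_zero]
        ring
      · rw [if_neg (by omega), if_neg (by omega), if_neg (by omega)]
        ring

/-- k-step transition probabilities of the uniformized chain: target states `(0, j2)`, `j2 ≥ 1`. -/
theorem uniformized_kstep_boundary2 (Q1 Q2 : ℕ) (hQ1 : 1 ≤ Q1) (hQ2 : 1 ≤ Q2)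
    (lam1 lam2 p12 p21 : ℝ) (hl1 : 0 < lam1) (hl2 : 0 < lam2)
    (hp12 : p12 ∈ Set.Icc (0 : ℝ) 1) (hp21 : p21 ∈ Set.Icc (0 : ℝ) 1)
    (j2 : ℕ) (hj2l : 1 ≤ j2) (hj2u : j2 ≤ Q2) (k : ℕ) :
    ((1 + (lam1 + lam2)⁻¹ •
        invGen Q1 Q2 lam1 lam2 (lam1 + lam2 * p21) (lam2 + lam1 * p12)) ^ k)
      (⟨Q1, by omega⟩, ⟨Q2, by omega⟩) (⟨0, by omega⟩, ⟨j2, by omega⟩) =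
      if Q1 + Q2 - j2 ≤ k then
        ∑ l ∈ Finset.Icc Q1 (Q1 + Q2 - j2),
          (Nat.choose (l - 1) (Q1 - 1) : ℝ) * (lam1 / (lam1 + lam2)) ^ Q1 *
            (lam2 / (lam1 + lam2)) ^ (l - Q1) *
          (Nat.choose (k - l) (Q1 + Q2 - j2 - l) : ℝ) *
            ((lam2 + lam1 * p12) / (lam1 + lam2)) ^ (Q1 + Q2 - j2 - l) *
            (((lam1 + lam2) - (lam2 + lam1 * p12)) / (lam1 + lam2)) ^ (k - (Q1 + Q2 - j2))
      else 0 := by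
  have hs : lam1 + lam2 ≠ 0 := by positivity
  rw [invPow_eq Q1 Q2 lam1 lam2 _ _ _ (inv_mul_cancel₀ hs) j2 hj2l, if_pos hj2u, kstepH]
  rw [← Nat.add_sub_assoc hj2u]
  split_ifs with h
  · rw [← Finset.Ico_add_one_right_eq_Icc, Finset.sum_Ico_eq_sum_range,
      show Q1 + Q2 - j2 + 1 - Q1 = Q2 - j2 + 1 by omega]
    refine Finset.sum_congr rfl fun m _ => ?_
    rw [Nat.multichoose_eq, show Q1 + m - Q1 = m by omega,
      show Q1 + Q2 - j2 - (Q1 + m) = Q2 - j2 - m by omega,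
      show (Q1 + m - 1).choose m = (Q1 + m - 1).choose (Q1 - 1) from
        Nat.choose_symm_of_eq_add (by omega),
      show (lam1 + lam2)⁻¹ * lam1 = lam1 / (lam1 + lam2) by ring,
      show (lam1 + lam2)⁻¹ * lam2 = lam2 / (lam1 + lam2) by ring,
      show (lam1 + lam2)⁻¹ * (lam2 + lam1 * p12) = (lam2 + lam1 * p12) / (lam1 + lam2) by ring,
      sub_div (lam1 + lam2), div_self hs]
  · rfl
end

section
/- The explicitly defined vector v on S = {0,…,Q1}×{0,…,Q2} satisfies the global balance equations of the inventory chain with random replenishment, i.e. the row vector v annihilates the generator: v · Q⁽²⁾ = 0 (equivalently, Σ_{(i1,i2)∈S} v(i1,i2)·Q⁽²⁾_{(i1,i2),(j1,j2)} = 0 for every state (j1,j2) ∈ S). -/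
open scoped BigOperators

/-- Generator `Q⁽²⁾` with random replenishment: every state other than `(Q1, Q2)` gets an
additional rate `m` to `(Q1, Q2)` and its diagonal entry is decreased by `m`. -/
noncomputable def invGenRepl (Q1 Q2 : ℕ) (l1 l2 s1 s2 m : ℝ) :
    Matrix (Fin (Q1 + 1) × Fin (Q2 + 1)) (Fin (Q1 + 1) × Fin (Q2 + 1)) ℝ :=
  fun i j =>
    invGen Q1 Q2 l1 l2 s1 s2 i j +
      (if i ≠ (⟨Q1, Nat.lt_succ_self Q1⟩, ⟨Q2, Nat.lt_succ_self Q2⟩) ∧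
          j = (⟨Q1, Nat.lt_succ_self Q1⟩, ⟨Q2, Nat.lt_succ_self Q2⟩) then m else 0) +
      (if i ≠ (⟨Q1, Nat.lt_succ_self Q1⟩, ⟨Q2, Nat.lt_succ_self Q2⟩) ∧ j = i then -m else 0)

/-- The explicit candidate stationary vector of Theorem 3 (eqs. (4.1)-(4.4)). -/
noncomputable def statVec (Q1 Q2 : ℕ) (l1 l2 mu p12 p21 : ℝ) :
    Fin (Q1 + 1) × Fin (Q2 + 1) → ℝ := fun j =>
  let s : ℝ := l1 + l2
  let s1 : ℝ := l1 + l2 * p21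
  let s2 : ℝ := l2 + l1 * p12
  let q1 : ℝ := l1 / (s + mu)
  let q2 : ℝ := l2 / (s + mu)
  let q3 : ℝ := mu / (s + mu)
  let A1 : ℝ := s1 / (s1 + mu)
  let A2 : ℝ := s2 / (s2 + mu)
  let B1 : ℝ := l1 / (s2 + mu)
  let B2 : ℝ := l2 / (s1 + mu)
  if 1 ≤ (j.1 : ℕ) ∧ 1 ≤ (j.2 : ℕ) then
    (Nat.choose ((Q1 - (j.1 : ℕ)) + (Q2 - (j.2 : ℕ))) (Q1 - (j.1 : ℕ)) : ℝ) *
      q1 ^ (Q1 - (j.1 : ℕ)) * q2 ^ (Q2 - (j.2 : ℕ)) * q3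
  else if 1 ≤ (j.1 : ℕ) ∧ (j.2 : ℕ) = 0 then
    B2 * q2 ^ (Q2 - 1) * q3 *
      ∑ k ∈ Finset.range (Q1 - (j.1 : ℕ) + 1),
        A1 ^ (Q1 - (j.1 : ℕ) - k) * q1 ^ k * (Nat.choose (Q2 + k - 1) k : ℝ)
  else if (j.1 : ℕ) = 0 ∧ 1 ≤ (j.2 : ℕ) then
    B1 * q1 ^ (Q1 - 1) * q3 *
      ∑ k ∈ Finset.range (Q2 - (j.2 : ℕ) + 1),
        A2 ^ (Q2 - (j.2 : ℕ) - k) * q2 ^ k * (Nat.choose (Q1 + k - 1) k : ℝ)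
  else
    (s1 / mu) * B2 * q2 ^ (Q2 - 1) * q3 *
        (∑ k ∈ Finset.range Q1,
          A1 ^ (Q1 - 1 - k) * q1 ^ k * (Nat.choose (Q2 + k - 1) k : ℝ)) +
      (s2 / mu) * B1 * q1 ^ (Q1 - 1) * q3 *
        (∑ k ∈ Finset.range Q2,
          A2 ^ (Q2 - 1 - k) * q2 ^ k * (Nat.choose (Q1 + k - 1) k : ℝ))

/-- Natural-number indexed version of `statVec`. -/
noncomputable def statN (Q1 Q2 : ℕ) (l1 l2 mu s1 s2 : ℝ) (a b : ℕ) : ℝ :=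
  if 1 ≤ a ∧ 1 ≤ b then
    (Nat.choose ((Q1 - a) + (Q2 - b)) (Q1 - a) : ℝ) *
      (l1 / (l1 + l2 + mu)) ^ (Q1 - a) * (l2 / (l1 + l2 + mu)) ^ (Q2 - b) * (mu / (l1 + l2 + mu))
  else if 1 ≤ a ∧ b = 0 then
    l2 / (s1 + mu) * (l2 / (l1 + l2 + mu)) ^ (Q2 - 1) * (mu / (l1 + l2 + mu)) *
      ∑ k ∈ Finset.range (Q1 - a + 1),
        (s1 / (s1 + mu)) ^ (Q1 - a - k) * (l1 / (l1 + l2 + mu)) ^ k *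
          (Nat.choose (Q2 + k - 1) k : ℝ)
  else if a = 0 ∧ 1 ≤ b then
    l1 / (s2 + mu) * (l1 / (l1 + l2 + mu)) ^ (Q1 - 1) * (mu / (l1 + l2 + mu)) *
      ∑ k ∈ Finset.range (Q2 - b + 1),
        (s2 / (s2 + mu)) ^ (Q2 - b - k) * (l2 / (l1 + l2 + mu)) ^ k *
          (Nat.choose (Q1 + k - 1) k : ℝ)
  else
    (s1 / mu) * (l2 / (s1 + mu)) * (l2 / (l1 + l2 + mu)) ^ (Q2 - 1) * (mu / (l1 + l2 + mu)) *
        (∑ k ∈ Finset.range Q1,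
          (s1 / (s1 + mu)) ^ (Q1 - 1 - k) * (l1 / (l1 + l2 + mu)) ^ k *
            (Nat.choose (Q2 + k - 1) k : ℝ)) +
      (s2 / mu) * (l1 / (s2 + mu)) * (l1 / (l1 + l2 + mu)) ^ (Q1 - 1) * (mu / (l1 + l2 + mu)) *
        (∑ k ∈ Finset.range Q2,
          (s2 / (s2 + mu)) ^ (Q2 - 1 - k) * (l2 / (l1 + l2 + mu)) ^ k *
            (Nat.choose (Q1 + k - 1) k : ℝ))

lemma statVec_eq (Q1 Q2 : ℕ) (l1 l2 mu p12 p21 : ℝ) (i : Fin (Q1 + 1) × Fin (Q2 + 1)) :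
    statVec Q1 Q2 l1 l2 mu p12 p21 i =
      statN Q1 Q2 l1 l2 mu (l1 + l2 * p21) (l2 + l1 * p12) i.1 i.2 := rfl

lemma sum_rec (A q : ℝ) (c : ℕ → ℝ) (x : ℕ) :
    ∑ k ∈ Finset.range (x + 1 + 1), A ^ (x + 1 - k) * q ^ k * c k =
      A * (∑ k ∈ Finset.range (x + 1), A ^ (x - k) * q ^ k * c k) + q ^ (x + 1) * c (x + 1) := by
  rw [Finset.sum_range_succ, Finset.mul_sum]
  congr 1
  · apply Finset.sum_congr rfl
    intro k hk
    have : x + 1 - k = (x - k) + 1 := by have := Finset.mem_range.1 hk; omega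
    rw [this, pow_succ]; ring
  · simp

/-- Total exit rate without replenishment. -/
noncomputable def outR (l1 l2 s1 s2 : ℝ) (a b : ℕ) : ℝ :=
  if 1 ≤ a ∧ 1 ≤ b then l1 + l2 else if 1 ≤ a ∧ b = 0 then s1
    else if a = 0 ∧ 1 ≤ b then s2 else 0

lemma bal_nat (Q1 Q2 : ℕ) (hQ1 : 1 ≤ Q1) (hQ2 : 1 ≤ Q2) (l1 l2 mu s1 s2 : ℝ)
    (hl1 : 0 < l1) (hl2 : 0 < l2) (hmu : 0 < mu) (hs1 : 0 < s1) (hs2 : 0 < s2)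
    (a b : ℕ) (ha : a ≤ Q1) (hb : b ≤ Q2) (hne : ¬ (a = Q1 ∧ b = Q2)) :
    (outR l1 l2 s1 s2 a b + mu) * statN Q1 Q2 l1 l2 mu s1 s2 a b =
      (if a + 1 ≤ Q1 ∧ b ≤ Q2 then
        statN Q1 Q2 l1 l2 mu s1 s2 (a + 1) b * (if b = 0 then s1 else l1) else 0) +
      (if a ≤ Q1 ∧ b + 1 ≤ Q2 then
        statN Q1 Q2 l1 l2 mu s1 s2 a (b + 1) * (if a = 0 then s2 else l2) else 0) := by
  have h0 : l1 + l2 + mu ≠ 0 := by positivity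
  have h1 : s1 + mu ≠ 0 := by positivity
  have h2 : s2 + mu ≠ 0 := by positivity
  obtain ⟨x, rfl⟩ := Nat.exists_eq_add_of_le ha
  obtain ⟨y, rfl⟩ := Nat.exists_eq_add_of_le hb
  rcases Nat.eq_zero_or_pos a with rfl | ha'
  · rcases Nat.eq_zero_or_pos b with rfl | hb'
    · obtain ⟨x, rfl⟩ : ∃ z, x = z + 1 := ⟨x - 1, by omega⟩
      obtain ⟨y, rfl⟩ : ∃ z, y = z + 1 := ⟨y - 1, by omega⟩
      simp [statN, outR]
      field_simp
    · obtain ⟨b, rfl⟩ : ∃ z, b = z + 1 := ⟨b - 1, by omega⟩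
      obtain ⟨x, rfl⟩ : ∃ z, x = z + 1 := ⟨x - 1, by omega⟩
      rcases y with _ | y
      · simp [statN, outR]
        field_simp
      · have e1 : b + 1 + (y + 1) - (b + 1) = y + 1 := by omega
        have e2 : b + 1 + (y + 1) - (b + 1 + 1) = y := by omega
        have e3 : 0 + (x + 1) + (y + 1) - 1 = x + (y + 1) := by omega
        have c : ((x + (y + 1)).choose x : ℝ) = ((x + (y + 1)).choose (y + 1) : ℝ) := by
          rw [Nat.choose_symm_add]
        simp only [statN, outR, e1, e2, sum_rec, e3]
        simp [e1, e2, c]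
        field_simp
        ring
  · obtain ⟨a, rfl⟩ : ∃ z, a = z + 1 := ⟨a - 1, by omega⟩
    rcases Nat.eq_zero_or_pos b with rfl | hb'
    · obtain ⟨y, rfl⟩ : ∃ z, y = z + 1 := ⟨y - 1, by omega⟩
      rcases x with _ | x
      · simp [statN, outR]
        field_simp
      · have e1 : a + 1 + (x + 1) - (a + 1) = x + 1 := by omega
        have e2 : a + 1 + (x + 1) - (a + 1 + 1) = x := by omega
        have e3 : 0 + (y + 1) + (x + 1) - 1 = x + 1 + y := by omega
        simp only [statN, outR, e1, e2, sum_rec, e3]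
        simp [e1, e2]
        field_simp
    · obtain ⟨b, rfl⟩ : ∃ z, b = z + 1 := ⟨b - 1, by omega⟩
      rcases x with _ | x <;> rcases y with _ | y
      · simp at hne
      · have e1 : b + 1 + (y + 1) - (b + 1) = y + 1 := by omega
        have e2 : b + 1 + (y + 1) - (b + 1 + 1) = y := by omega
        simp [statN, outR, e1, e2, pow_succ]
        field_simp
      · have e1 : a + 1 + (x + 1) - (a + 1) = x + 1 := by omega
        have e2 : a + 1 + (x + 1) - (a + 1 + 1) = x := by omega
        simp [statN, outR, e1, e2, pow_succ]
        field_simp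
      · have e1 : b + 1 + (y + 1) - (b + 1) = y + 1 := by omega
        have e2 : b + 1 + (y + 1) - (b + 1 + 1) = y := by omega
        have e3 : a + 1 + (x + 1) - (a + 1) = x + 1 := by omega
        have e4 : a + 1 + (x + 1) - (a + 1 + 1) = x := by omega
        have c : ((x + 1 + (y + 1)).choose (x + 1) : ℝ) =
            ((x + (y + 1)).choose x : ℝ) + ((x + 1 + y).choose (x + 1) : ℝ) := by
          rw [show x + 1 + (y + 1) = (x + (y + 1)) + 1 by ring, Nat.choose_succ_succ,
            show x + 1 + y = x + (y + 1) by ring]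
          push_cast; rfl
        simp [statN, outR, e1, e2, e3, e4, c, pow_succ]
        field_simp

lemma sum_pick (Q1 Q2 : ℕ) (f : ℕ → ℕ → ℝ) (a b : ℕ) (c : ℝ) :
    ∑ i : Fin (Q1 + 1) × Fin (Q2 + 1),
      f i.1 i.2 * (if (i.1 : ℕ) = a ∧ (i.2 : ℕ) = b then c else 0) =
      if a ≤ Q1 ∧ b ≤ Q2 then f a b * c else 0 := by
  split_ifs with h
  · rw [Finset.sum_eq_single (⟨a, by omega⟩, ⟨b, by omega⟩)]
    · simp
    · rintro ⟨i, k⟩ _ hi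
      rw [if_neg, mul_zero]
      rintro ⟨h1, h2⟩
      exact hi (Prod.ext (Fin.ext h1) (Fin.ext h2))
    · simp
  · apply Finset.sum_eq_zero
    rintro ⟨i, k⟩ _
    rw [if_neg, mul_zero]
    have := i.2
    have := k.2
    rintro ⟨h1, h2⟩
    simp only at h1 h2
    omega

lemma gen_eq (Q1 Q2 : ℕ) (l1 l2 s1 s2 m : ℝ) (i j : Fin (Q1 + 1) × Fin (Q2 + 1))
    (hj : ¬ ((j.1 : ℕ) = Q1 ∧ (j.2 : ℕ) = Q2)) :
    invGenRepl Q1 Q2 l1 l2 s1 s2 m i j =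
      (if (i.1 : ℕ) = j.1 ∧ (i.2 : ℕ) = j.2 then -(outR l1 l2 s1 s2 j.1 j.2 + m) else 0) +
      (if (i.1 : ℕ) = j.1 + 1 ∧ (i.2 : ℕ) = j.2 then (if (j.2 : ℕ) = 0 then s1 else l1) else 0) +
      (if (i.1 : ℕ) = j.1 ∧ (i.2 : ℕ) = j.2 + 1 then
        (if (j.1 : ℕ) = 0 then s2 else l2) else 0) := by
  obtain ⟨⟨i1, hi1⟩, ⟨i2, hi2⟩⟩ := i
  obtain ⟨⟨j1, hj1⟩, ⟨j2, hj2⟩⟩ := j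
  simp only [invGenRepl, invGen, outR, Prod.mk.injEq, Fin.mk.injEq, ne_eq] at *
  rcases i1 with _ | i1 <;> rcases i2 with _ | i2 <;> grind

lemma row_sum (Q1 Q2 : ℕ) (l1 l2 s1 s2 m : ℝ) (i : Fin (Q1 + 1) × Fin (Q2 + 1)) :
    ∑ j, invGenRepl Q1 Q2 l1 l2 s1 s2 m i j = 0 := by
  have key : ∀ a b : ℕ, a ≤ Q1 → b ≤ Q2 → ∀ c : ℝ, ∑ j : Fin (Q1 + 1) × Fin (Q2 + 1),
      (if (j.1 : ℕ) = a ∧ (j.2 : ℕ) = b then c else 0) = c := by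
    intro a b ha hb c
    have := sum_pick Q1 Q2 (fun _ _ => 1) a b c
    simpa [ha, hb] using this
  obtain ⟨⟨i1, hi1⟩, ⟨i2, hi2⟩⟩ := i
  have hP : ∀ (j : Fin (Q1 + 1) × Fin (Q2 + 1)) (a b : ℕ) (ha : a < Q1 + 1) (hb : b < Q2 + 1),
      (j = (⟨a, ha⟩, ⟨b, hb⟩)) = ((j.1 : ℕ) = a ∧ (j.2 : ℕ) = b) := by
    intro j a b ha hb
    simp [Prod.ext_iff, Fin.ext_iff]
  have hI : ∀ (P R : Prop) [Decidable P] [Decidable R] (c : ℝ),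
      (if P ∧ R then c else 0) = if R then (if P then c else 0) else 0 := by
    intro P R _ _ c; split_ifs <;> tauto
  simp only [invGenRepl, Finset.sum_add_distrib]
  have r1 : ∑ j, invGen Q1 Q2 l1 l2 s1 s2 (⟨i1, hi1⟩, ⟨i2, hi2⟩) j = 0 := by
    simp only [invGen, hP]
    split_ifs with h1 h2 h3
    · simp only [Finset.sum_add_distrib]
      rw [key _ _ (by omega) (by omega), key _ _ (by omega) (by omega),
        key _ _ (by omega) (by omega)]
      ring
    · simp only [Finset.sum_add_distrib]
      rw [key _ _ (by omega) (by omega), key _ _ (by omega) (by omega)]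
      ring
    · simp only [Finset.sum_add_distrib]
      rw [key _ _ (by omega) (by omega), key _ _ (by omega) (by omega)]
      ring
    · simp
  rw [r1]
  by_cases h : ((⟨i1, hi1⟩, ⟨i2, hi2⟩) : Fin (Q1 + 1) × Fin (Q2 + 1)) =
      (⟨Q1, Nat.lt_succ_self Q1⟩, ⟨Q2, Nat.lt_succ_self Q2⟩)
  · simp [h]
  · simp only [ne_eq, h, not_false_eq_true, true_and]
    simp

/-- **Theorem 3 (balance equations).** The explicit vector `statVec` annihilates the
generator `Q⁽²⁾` of the inventory chain with random replenishment: `v · Q⁽²⁾ = 0`. -/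
theorem statVec_balance (Q1 Q2 : ℕ) (hQ1 : 1 ≤ Q1) (hQ2 : 1 ≤ Q2)
    (lam1 lam2 mu p12 p21 : ℝ) (hl1 : 0 < lam1) (hl2 : 0 < lam2) (hmu : 0 < mu)
    (hp12 : p12 ∈ Set.Icc (0 : ℝ) 1) (hp21 : p21 ∈ Set.Icc (0 : ℝ) 1) :
    ∀ j : Fin (Q1 + 1) × Fin (Q2 + 1),
      ∑ i : Fin (Q1 + 1) × Fin (Q2 + 1),
        statVec Q1 Q2 lam1 lam2 mu p12 p21 i *
          invGenRepl Q1 Q2 lam1 lam2 (lam1 + lam2 * p21) (lam2 + lam1 * p12) mu i j = 0 := by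
  have hs1 : 0 < lam1 + lam2 * p21 := by
    have := mul_nonneg hl2.le hp21.1
    linarith
  have hs2 : 0 < lam2 + lam1 * p12 := by
    have := mul_nonneg hl1.le hp12.1
    linarith
  have main : ∀ j : Fin (Q1 + 1) × Fin (Q2 + 1), ¬ ((j.1 : ℕ) = Q1 ∧ (j.2 : ℕ) = Q2) →
      ∑ i : Fin (Q1 + 1) × Fin (Q2 + 1),
        statVec Q1 Q2 lam1 lam2 mu p12 p21 i *
          invGenRepl Q1 Q2 lam1 lam2 (lam1 + lam2 * p21) (lam2 + lam1 * p12) mu i j = 0 := by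
    intro j hj
    have ha : (j.1 : ℕ) ≤ Q1 := by have := j.1.2; omega
    have hb : (j.2 : ℕ) ≤ Q2 := by have := j.2.2; omega
    have hbal := bal_nat Q1 Q2 hQ1 hQ2 lam1 lam2 mu _ _ hl1 hl2 hmu hs1 hs2 j.1 j.2 ha hb hj
    simp only [statVec_eq, gen_eq _ _ _ _ _ _ _ _ _ hj, mul_add, Finset.sum_add_distrib]
    rw [sum_pick, sum_pick, sum_pick, if_pos ⟨ha, hb⟩]
    linarith
  intro j
  by_cases hj : (j.1 : ℕ) = Q1 ∧ (j.2 : ℕ) = Q2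
  · have tot : ∑ j : Fin (Q1 + 1) × Fin (Q2 + 1), ∑ i : Fin (Q1 + 1) × Fin (Q2 + 1),
        statVec Q1 Q2 lam1 lam2 mu p12 p21 i *
          invGenRepl Q1 Q2 lam1 lam2 (lam1 + lam2 * p21) (lam2 + lam1 * p12) mu i j = 0 := by
      rw [Finset.sum_comm]
      simp only [← Finset.mul_sum, row_sum, mul_zero, Finset.sum_const_zero]
    rw [Finset.sum_eq_single j] at tot
    · exact tot
    · intro k _ hk
      apply main
      rintro ⟨h1, h2⟩
      exact hk (Prod.ext (Fin.ext (h1.trans hj.1.symm)) (Fin.ext (h2.trans hj.2.symm)))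
    · simp
  · exact main j hj
end

section
/- The explicitly defined vector v on S = {0,…,Q1}×{0,…,Q2} is normalized: Σ_{(i1,i2)∈S} v(i1,i2) = 1 (together with the balance equations this identifies v as the stationary distribution of the inventory chain with random replenishment). -/
open scoped BigOperators

/-- Row identity for the array `C(i+j,i) x^i y^j`. -/
theorem aux_row (x y : ℝ) (i b : ℕ) :
    (∑ j ∈ Finset.range (b + 1), (Nat.choose (i + 1 + j) (i + 1) : ℝ) * x ^ (i + 1) * y ^ j)
        * (1 - y) + y * ((Nat.choose (i + 1 + b) (i + 1) : ℝ) * x ^ (i + 1) * y ^ b)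
      = x * ∑ j ∈ Finset.range (b + 1), (Nat.choose (i + j) i : ℝ) * x ^ i * y ^ j := by
  induction b with
  | zero => simp; ring
  | succ b ih =>
    rw [Finset.sum_range_succ, Finset.sum_range_succ _ (b + 1)]
    have h : (Nat.choose (i + 1 + (b + 1)) (i + 1) : ℝ)
        = Nat.choose (i + (b + 1)) i + Nat.choose (i + 1 + b) (i + 1) := by
      have : i + 1 + (b + 1) = (i + (b + 1)) + 1 := by ring
      rw [this, Nat.choose_succ_succ, show i + (b + 1) = i + 1 + b by ring]
      push_cast
      ring
    rw [mul_add x, ← ih, h]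
    ring

theorem aux_zero (y : ℝ) (b : ℕ) :
    (∑ j ∈ Finset.range (b + 1), y ^ j) * (1 - y) + y * y ^ b = 1 := by
  induction b with
  | zero => simp
  | succ b ih =>
    rw [Finset.sum_range_succ]
    linear_combination ih

theorem aux_total (x y : ℝ) (a b : ℕ) :
    (1 - x - y) * (∑ i ∈ Finset.range (a + 1), ∑ j ∈ Finset.range (b + 1),
        (Nat.choose (i + j) i : ℝ) * x ^ i * y ^ j)
      + y * (∑ i ∈ Finset.range (a + 1), (Nat.choose (i + b) i : ℝ) * x ^ i * y ^ b)
      + x * (∑ j ∈ Finset.range (b + 1), (Nat.choose (a + j) a : ℝ) * x ^ a * y ^ j) = 1 := by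
  induction a with
  | zero =>
    simp only [zero_add, Finset.sum_range_one, Nat.choose_zero_right, pow_zero, Nat.cast_one,
      one_mul]
    linear_combination aux_zero y b
  | succ a ih =>
    rw [Finset.sum_range_succ, Finset.sum_range_succ _ (a + 1)]
    linear_combination ih + aux_row x y a b

/-- Convolution with a geometric sequence. -/
theorem aux_conv (A r : ℝ) (h : (1 + r) * A = r) (c : ℕ → ℝ) (a : ℕ) :
    (∑ i ∈ Finset.range (a + 1), ∑ k ∈ Finset.range (i + 1), A ^ (i - k) * c k)
      + r * (∑ k ∈ Finset.range (a + 1), A ^ (a - k) * c k)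
      = (1 + r) * ∑ k ∈ Finset.range (a + 1), c k := by
  induction a with
  | zero => simp; ring
  | succ a ih =>
    have hS : (∑ k ∈ Finset.range (a + 1 + 1), A ^ (a + 1 - k) * c k)
        = A * (∑ k ∈ Finset.range (a + 1), A ^ (a - k) * c k) + c (a + 1) := by
      rw [Finset.sum_range_succ, Finset.mul_sum]
      congr 1
      · refine Finset.sum_congr rfl fun k hk => ?_
        have : a + 1 - k = (a - k) + 1 := by
          have := Finset.mem_range.mp hk
          omega
        rw [this, pow_succ]
        ring
      · simp
    rw [Finset.sum_range_succ, hS, Finset.sum_range_succ c]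
    linear_combination ih + (∑ k ∈ Finset.range (a + 1), A ^ (a - k) * c k) * h

theorem aux_reflect (G : ℕ → ℝ) (a : ℕ) :
    ∑ i : Fin (a + 1), G (a - (i : ℕ)) = ∑ i ∈ Finset.range (a + 1), G i := by
  rw [Fin.sum_univ_eq_sum_range (fun i => G (a - i)) (a + 1)]
  exact Finset.sum_range_reflect G (a + 1)

/-- The boundary contribution, in closed form. -/
theorem aux_boundary (x y q A r B K : ℝ) (h : (1 + r) * A = r) (hK : B * q * (1 + r) = y)
    (hr : K = r) (a b : ℕ) :
    (∑ i ∈ Finset.range (a + 1), B * y ^ b * q * ∑ k ∈ Finset.range (i + 1),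
        A ^ (i - k) * x ^ k * (Nat.choose (b + k) k : ℝ))
      + K * B * y ^ b * q * (∑ k ∈ Finset.range (a + 1),
        A ^ (a - k) * x ^ k * (Nat.choose (b + k) k : ℝ))
      = y * ∑ k ∈ Finset.range (a + 1), (Nat.choose (k + b) k : ℝ) * x ^ k * y ^ b := by
  have := aux_conv A r h (fun k => x ^ k * (Nat.choose (b + k) k : ℝ)) a
  have e : ∑ k ∈ Finset.range (a + 1), (Nat.choose (k + b) k : ℝ) * x ^ k * y ^ b
      = y ^ b * ∑ k ∈ Finset.range (a + 1), x ^ k * (Nat.choose (b + k) k : ℝ) := by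
    rw [Finset.mul_sum]
    refine Finset.sum_congr rfl fun k _ => ?_
    rw [add_comm k b]
    ring
  rw [e, ← Finset.mul_sum, hr]
  simp only [← mul_assoc] at this ⊢
  linear_combination B * y ^ b * q * this
    + (y ^ b * ∑ k ∈ Finset.range (a + 1), x ^ k * (Nat.choose (b + k) k : ℝ)) * hK

/-- **Theorem 3 (normalization).** The explicit vector `statVec` is a probability vector:
its entries sum to one. -/
theorem statVec_normalized (Q1 Q2 : ℕ) (hQ1 : 1 ≤ Q1) (hQ2 : 1 ≤ Q2)
    (lam1 lam2 mu p12 p21 : ℝ) (hl1 : 0 < lam1) (hl2 : 0 < lam2) (hmu : 0 < mu)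
    (hp12 : p12 ∈ Set.Icc (0 : ℝ) 1) (hp21 : p21 ∈ Set.Icc (0 : ℝ) 1) :
    ∑ i : Fin (Q1 + 1) × Fin (Q2 + 1), statVec Q1 Q2 lam1 lam2 mu p12 p21 i = 1 := by
  obtain ⟨a, rfl⟩ : ∃ a, Q1 = a + 1 := ⟨Q1 - 1, by omega⟩
  obtain ⟨b, rfl⟩ : ∃ b, Q2 = b + 1 := ⟨Q2 - 1, by omega⟩
  have hp1 := hp12.1
  have hp2 := hp21.1
  have hs1 : 0 < lam1 + lam2 * p21 + mu := by positivity
  have hs2 : 0 < lam2 + lam1 * p12 + mu := by positivity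
  have hs : 0 < lam1 + lam2 + mu := by positivity
  rw [Fintype.sum_prod_type, Fin.sum_univ_succ]
  simp only [Fin.sum_univ_succ (n := b + 1)]
  simp only [statVec, Fin.val_succ, Fin.val_zero, Nat.add_sub_add_right, Nat.add_sub_cancel,
    Nat.le_add_left, and_self, if_true, and_true, true_and, (by decide : ¬ (1 : ℕ) ≤ 0), if_false,
    and_false, false_and, Nat.add_eq_zero_iff, one_ne_zero, Nat.add_right_comm _ 1]
  rw [Finset.sum_add_distrib]
  set x := lam1 / (lam1 + lam2 + mu) with hx
  set y := lam2 / (lam1 + lam2 + mu) with hy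
  set q := mu / (lam1 + lam2 + mu) with hq
  set A1 := (lam1 + lam2 * p21) / (lam1 + lam2 * p21 + mu) with hA1
  set A2 := (lam2 + lam1 * p12) / (lam2 + lam1 * p12 + mu) with hA2
  set B1 := lam1 / (lam2 + lam1 * p12 + mu) with hB1
  set B2 := lam2 / (lam1 + lam2 * p21 + mu) with hB2
  rw [aux_reflect (fun i => B2 * y ^ b * q * ∑ k ∈ Finset.range (i + 1),
        A1 ^ (i - k) * x ^ k * (Nat.choose (b + k) k : ℝ)) a,
    aux_reflect (fun i => B1 * x ^ a * q * ∑ k ∈ Finset.range (i + 1),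
        A2 ^ (i - k) * y ^ k * (Nat.choose (a + k) k : ℝ)) b]
  have hD : ∑ i : Fin (a + 1), ∑ j : Fin (b + 1),
      (Nat.choose (a - (i : ℕ) + (b - (j : ℕ))) (a - (i : ℕ)) : ℝ) * x ^ (a - (i : ℕ))
        * y ^ (b - (j : ℕ)) * q
      = (1 - x - y) * ∑ i ∈ Finset.range (a + 1), ∑ j ∈ Finset.range (b + 1),
        (Nat.choose (i + j) i : ℝ) * x ^ i * y ^ j := by
    have hq' : 1 - x - y = q := by
      rw [hx, hy, hq]
      field_simp
      ring
    rw [hq', mul_comm, Finset.sum_mul, ← aux_reflect]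
    refine Finset.sum_congr rfl fun i _ => ?_
    rw [Finset.sum_mul, ← aux_reflect]
  rw [hD]
  have h1 := aux_boundary x y q A1 ((lam1 + lam2 * p21) / mu) B2 _
    (by rw [hA1]; field_simp; ring) (by rw [hB2, hq, hy]; field_simp; ring) rfl a b
  have h2 := aux_boundary y x q A2 ((lam2 + lam1 * p12) / mu) B1 _
    (by rw [hA2]; field_simp; ring) (by rw [hB1, hq, hx]; field_simp; ring) rfl b a
  have e2 : ∑ k ∈ Finset.range (b + 1), (Nat.choose (k + a) k : ℝ) * y ^ k * x ^ a
      = ∑ j ∈ Finset.range (b + 1), (Nat.choose (a + j) a : ℝ) * x ^ a * y ^ j := by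
    refine Finset.sum_congr rfl fun k _ => ?_
    rw [add_comm k a, Nat.choose_symm_add]
    ring
  rw [e2] at h2
  linear_combination aux_total x y a b + h1 + h2
end

section
/- The expected stationary inventory levels under random replenishment are supermodular in the order quantities: for all integers Q1, Q2 ≥ 1, if for each pair (a,b) ∈ {(Q1,Q2),(Q1+1,Q2),(Q1,Q2+1),(Q1+1,Q2+1)} the vector v^{(a,b)} is a probability vector on S_{a,b} (nonnegative entries summing to 1) satisfying v^{(a,b)} · Q⁽²⁾_{a,b} = 0, and Em_i(a,b) = Σ_{(j1,j2)∈S_{a,b}} j_i · v^{(a,b)}(j1,j2), then for each product i ∈ {1,2}: Em_i(Q1+1,Q2+1) − Em_i(Q1+1,Q2) ≥ Em_i(Q1,Q2+1) − Em_i(Q1,Q2). -/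
open scoped BigOperators

/-- Indicator sum over the product state space. -/
lemma sum_ind_inv (a b : ℕ) (h : ℕ → ℕ → ℝ) (c : ℝ) (x y : ℕ) (hx : x ≤ a) (hy : y ≤ b) :
    ∑ j : Fin (a + 1) × Fin (b + 1),
      (if (j.1 : ℕ) = x ∧ (j.2 : ℕ) = y then c else 0) * h j.1 j.2 = c * h x y := by
  rw [Finset.sum_eq_single (⟨x, by omega⟩, ⟨y, by omega⟩)]
  · simp
  · rintro ⟨j1, j2⟩ _ hne
    rw [if_neg, zero_mul]
    rintro ⟨h1, h2⟩
    exact hne (Prod.ext (Fin.ext h1) (Fin.ext h2))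
  · simp

lemma sum_ind_eq_inv (a b : ℕ) (h : ℕ → ℕ → ℝ) (c : ℝ) (i : Fin (a + 1) × Fin (b + 1)) :
    ∑ j : Fin (a + 1) × Fin (b + 1), (if j = i then c else 0) * h j.1 j.2 = c * h i.1 i.2 := by
  simp [ite_mul]

/-- The resolvent equation turns the balance equations into a formula for expectations. -/
lemma expect_eq_resolvent (a b : ℕ) (l1 l2 s1 s2 m : ℝ) (hm : 0 < m)
    (h f : ℕ → ℕ → ℝ)
    (h00 : h 0 0 = f 0 0)
    (h10 : ∀ i, (m + s1) * h (i + 1) 0 = m * f (i + 1) 0 + s1 * h i 0)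
    (h01 : ∀ j, (m + s2) * h 0 (j + 1) = m * f 0 (j + 1) + s2 * h 0 j)
    (h11 : ∀ i j, (m + l1 + l2) * h (i + 1) (j + 1) =
      m * f (i + 1) (j + 1) + l1 * h i (j + 1) + l2 * h (i + 1) j)
    (v : Fin (a + 1) × Fin (b + 1) → ℝ) (hn : ∑ x, v x = 1)
    (hbal : ∀ j, ∑ i, v i * invGenRepl a b l1 l2 s1 s2 m i j = 0) :
    ∑ j, f j.1 j.2 * v j = h a b := by
  have row1 : ∀ i : Fin (a + 1) × Fin (b + 1),
      ∑ j, invGen a b l1 l2 s1 s2 i j * h j.1 j.2 = m * (h i.1 i.2 - f i.1 i.2) := by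
    rintro ⟨⟨i1, hi1⟩, ⟨i2, hi2⟩⟩
    unfold invGen
    rcases i1 with _ | i1 <;> rcases i2 with _ | i2
    · simp [h00]
    · have e1 := sum_ind_inv a b h s2 0 i2 (by omega) (by omega)
      have e2 := sum_ind_eq_inv a b h (-s2) (⟨0, hi1⟩, ⟨i2 + 1, hi2⟩)
      simp [add_mul, Finset.sum_add_distrib] at e1 e2 ⊢
      rw [e1, e2]; linarith [h01 i2]
    · have e1 := sum_ind_inv a b h s1 i1 0 (by omega) (by omega)
      have e2 := sum_ind_eq_inv a b h (-s1) (⟨i1 + 1, hi1⟩, ⟨0, hi2⟩)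
      simp [add_mul, Finset.sum_add_distrib] at e1 e2 ⊢
      rw [e1, e2]; linarith [h10 i1]
    · have e1 := sum_ind_inv a b h l1 i1 (i2 + 1) (by omega) (by omega)
      have e3 := sum_ind_inv a b h l2 (i1 + 1) i2 (by omega) (by omega)
      have e2 := sum_ind_eq_inv a b h (-(l1 + l2)) (⟨i1 + 1, hi1⟩, ⟨i2 + 1, hi2⟩)
      simp only [add_mul, Finset.sum_add_distrib, Nat.le_add_left, and_self, if_true,
        Nat.add_sub_cancel] at e1 e2 e3 ⊢
      rw [e1, e2, e3]; linarith [h11 i1 i2]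
  have row2 : ∀ i : Fin (a + 1) × Fin (b + 1),
      ∑ j, invGenRepl a b l1 l2 s1 s2 m i j * h j.1 j.2 = m * (h a b - f i.1 i.2) := by
    intro i
    unfold invGenRepl
    simp only [add_mul, Finset.sum_add_distrib]
    rw [row1]
    by_cases hi : i = (⟨a, Nat.lt_succ_self a⟩, ⟨b, Nat.lt_succ_self b⟩)
    · subst hi; simp
    · simp only [ne_eq, hi, not_false_eq_true, true_and]
      rw [sum_ind_eq_inv, sum_ind_eq_inv]
      ring
  have key : ∑ i, v i * (m * (h a b - f i.1 i.2)) = 0 := by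
    calc _ = ∑ i, ∑ j, v i * (invGenRepl a b l1 l2 s1 s2 m i j * h j.1 j.2) := by
          refine Finset.sum_congr rfl fun i _ => ?_
          rw [← row2, Finset.mul_sum]
      _ = ∑ j, (∑ i, v i * invGenRepl a b l1 l2 s1 s2 m i j) * h j.1 j.2 := by
          rw [Finset.sum_comm]
          refine Finset.sum_congr rfl fun j _ => ?_
          rw [Finset.sum_mul]
          exact Finset.sum_congr rfl fun i _ => by ring
      _ = 0 := by simp [hbal]
  have e : ∑ i, v i * (m * (h a b - f i.1 i.2)) =
      m * (h a b * ∑ i, v i - ∑ i, f i.1 i.2 * v i) := by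
    rw [Finset.mul_sum, ← Finset.sum_sub_distrib, Finset.mul_sum]
    exact Finset.sum_congr rfl fun i _ => by ring
  rw [e, hn] at key
  rcases mul_eq_zero.1 key with h0 | h0 <;> linarith

/-- The expected level of the first product at an exponential time, as a recursion. -/
noncomputable def resH (l1 l2 s1 m : ℝ) : ℕ → ℕ → ℝ
  | 0, _ => 0
  | i + 1, 0 => (m * (i + 1) + s1 * resH l1 l2 s1 m i 0) / (m + s1)
  | i + 1, j + 1 => (m * (i + 1) + l1 * resH l1 l2 s1 m i (j + 1) +
      l2 * resH l1 l2 s1 m (i + 1) j) / (m + l1 + l2)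

lemma resH_zero (l1 l2 s1 m : ℝ) (j : ℕ) : resH l1 l2 s1 m 0 j = 0 := by
  cases j <;> simp [resH]

lemma resH_10 (l1 l2 s1 m : ℝ) (hs1 : 0 < s1) (hm : 0 < m) (i : ℕ) :
    (m + s1) * resH l1 l2 s1 m (i + 1) 0 =
      m * ((i + 1 : ℕ) : ℝ) + s1 * resH l1 l2 s1 m i 0 := by
  have : m + s1 ≠ 0 := by positivity
  rw [resH]; push_cast; field_simp

lemma resH_11 (l1 l2 s1 m : ℝ) (hl1 : 0 < l1) (hl2 : 0 < l2) (hm : 0 < m) (i j : ℕ) :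
    (m + l1 + l2) * resH l1 l2 s1 m (i + 1) (j + 1) =
      m * ((i + 1 : ℕ) : ℝ) + l1 * resH l1 l2 s1 m i (j + 1) + l2 * resH l1 l2 s1 m (i + 1) j := by
  have : m + l1 + l2 ≠ 0 := by positivity
  rw [resH]; push_cast; field_simp

lemma resH_super (l1 l2 s1 m : ℝ) (hl1 : 0 < l1) (hl2 : 0 < l2) (hm : 0 < m) (hs : l1 ≤ s1)
    (i j : ℕ) :
    0 ≤ resH l1 l2 s1 m (i + 1) (j + 1) - resH l1 l2 s1 m (i + 1) j
      - resH l1 l2 s1 m i (j + 1) + resH l1 l2 s1 m i j := by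
  have hs1 : 0 < s1 := lt_of_lt_of_le hl1 hs
  have hM : 0 < m + l1 + l2 := by positivity
  have hM1 : 0 < m + s1 := by positivity
  have z := resH_zero l1 l2 s1 m
  have r10 := resH_10 l1 l2 s1 m hs1 hm
  have r11 := resH_11 l1 l2 s1 m hl1 hl2 hm
  generalize resH l1 l2 s1 m = h at *
  push_cast at r10 r11
  -- first differences on the axis are positive
  have d1 : 0 < h 1 0 := by
    have := r10 0
    rw [z] at this
    refine pos_of_mul_pos_right (a := m + s1) ?_ hM1.le
    rw [this]; simpa using hm
  -- convexity on the axis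
  have d2 : ∀ k, 0 ≤ h (k + 2) 0 - 2 * h (k + 1) 0 + h k 0 := by
    intro k
    induction k with
    | zero =>
      refine (mul_nonneg_iff_of_pos_left hM1).1 ?_
      have a1 := r10 0
      have a2 := r10 1
      have a3 := mul_pos hs1 d1
      simp only [z, zero_add] at *
      norm_num at *
      nlinarith
    | succ k ih =>
      refine (mul_nonneg_iff_of_pos_left hM1).1 ?_
      have a1 := r10 k
      have a2 := r10 (k + 1)
      have a3 := r10 (k + 2)
      have a4 := mul_nonneg hs1.le ih
      push_cast at *
      nlinarith
  have g : ∀ k, (m + l1 + l2) * (h (k + 1) 1 - h (k + 1) 0) =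
      l1 * (h k 1 - h k 0) + (s1 - l1) * (h (k + 1) 0 - h k 0) := by
    intro k
    have a1 := r11 k 0
    have a2 := r10 k
    simp only [zero_add] at a1
    linarith
  have D00 : 0 ≤ h 1 1 - h 1 0 - h 0 1 + h 0 0 := by
    have a := g 0
    have b := mul_nonneg (sub_nonneg.2 hs) d1.le
    refine (mul_nonneg_iff_of_pos_left hM).1 ?_
    simp only [z, zero_add] at *
    linarith
  induction j generalizing i with
  | zero =>
    induction i with
    | zero => simpa using D00
    | succ i ih =>
      have a1 := g i
      have a2 := g (i + 1)
      have a3 := mul_nonneg (sub_nonneg.2 hs) (d2 i)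
      have a4 := mul_nonneg hl1.le ih
      refine (mul_nonneg_iff_of_pos_left hM).1 ?_
      simp only [zero_add] at *
      linarith
  | succ j ihj =>
    induction i with
    | zero =>
      have a1 := r11 0 (j + 1)
      have a2 := r11 0 j
      have a4 := mul_nonneg hl2.le (ihj 0)
      refine (mul_nonneg_iff_of_pos_left hM).1 ?_
      simp only [z, zero_add] at *
      linarith
    | succ i ihi =>
      have a1 := r11 (i + 1) (j + 1)
      have a2 := r11 (i + 1) j
      have a5 := r11 i (j + 1)
      have a6 := r11 i j
      have a3 := mul_nonneg hl1.le ihi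
      have a4 := mul_nonneg hl2.le (ihj (i + 1))
      refine (mul_nonneg_iff_of_pos_left hM).1 ?_
      push_cast at *
      linarith

/-- **Supermodularity of expected stationary inventory levels under random replenishment**
(eq. (4.27)): if, for each of the four order-quantity pairs, `v` is a probability vector
solving the balance equations `v · Q⁽²⁾ = 0`, then the corresponding expected inventory
levels `Em_i` are supermodular, for each product `i ∈ {1, 2}`. -/
theorem expStatInv_supermodular (lam1 lam2 mu p12 p21 : ℝ)
    (hl1 : 0 < lam1) (hl2 : 0 < lam2) (hmu : 0 < mu)
    (hp12 : p12 ∈ Set.Icc (0 : ℝ) 1) (hp21 : p21 ∈ Set.Icc (0 : ℝ) 1)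
    (Q1 Q2 : ℕ) (hQ1 : 1 ≤ Q1) (hQ2 : 1 ≤ Q2)
    (v : (a : ℕ) → (b : ℕ) → (Fin (a + 1) × Fin (b + 1) → ℝ))
    (hnonneg : ∀ a b : ℕ, (a = Q1 ∨ a = Q1 + 1) → (b = Q2 ∨ b = Q2 + 1) →
      ∀ x : Fin (a + 1) × Fin (b + 1), 0 ≤ v a b x)
    (hnorm : ∀ a b : ℕ, (a = Q1 ∨ a = Q1 + 1) → (b = Q2 ∨ b = Q2 + 1) →
      ∑ x : Fin (a + 1) × Fin (b + 1), v a b x = 1)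
    (hbal : ∀ a b : ℕ, (a = Q1 ∨ a = Q1 + 1) → (b = Q2 ∨ b = Q2 + 1) →
      ∀ j : Fin (a + 1) × Fin (b + 1),
        ∑ i : Fin (a + 1) × Fin (b + 1),
          v a b i * invGenRepl a b lam1 lam2 (lam1 + lam2 * p21) (lam2 + lam1 * p12) mu i j
          = 0) :
    (let Em1 : (a : ℕ) → (b : ℕ) → ℝ := fun a b =>
      ∑ j : Fin (a + 1) × Fin (b + 1), ((j.1 : ℕ) : ℝ) * v a b j
    Em1 (Q1 + 1) (Q2 + 1) - Em1 (Q1 + 1) Q2 ≥ Em1 Q1 (Q2 + 1) - Em1 Q1 Q2) ∧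
    (let Em2 : (a : ℕ) → (b : ℕ) → ℝ := fun a b =>
      ∑ j : Fin (a + 1) × Fin (b + 1), ((j.2 : ℕ) : ℝ) * v a b j
    Em2 (Q1 + 1) (Q2 + 1) - Em2 (Q1 + 1) Q2 ≥ Em2 Q1 (Q2 + 1) - Em2 Q1 Q2) := by
  have hs1 : lam1 ≤ lam1 + lam2 * p21 := by nlinarith [mul_nonneg hl2.le hp21.1]
  have hs2 : lam2 ≤ lam2 + lam1 * p12 := by nlinarith [mul_nonneg hl1.le hp12.1]
  have hs1' := lt_of_lt_of_le hl1 hs1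
  have hs2' := lt_of_lt_of_le hl2 hs2
  have E1 : ∀ a b : ℕ, (a = Q1 ∨ a = Q1 + 1) → (b = Q2 ∨ b = Q2 + 1) →
      ∑ j : Fin (a + 1) × Fin (b + 1), ((j.1 : ℕ) : ℝ) * v a b j =
        resH lam1 lam2 (lam1 + lam2 * p21) mu a b := by
    intro a b ha hb
    refine expect_eq_resolvent a b lam1 lam2 _ _ mu hmu
      (resH lam1 lam2 (lam1 + lam2 * p21) mu) (fun i _ => (i : ℝ)) ?_ ?_ ?_ ?_ _
      (hnorm a b ha hb) (hbal a b ha hb)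
    · simp [resH_zero]
    · exact resH_10 _ _ _ _ hs1' hmu
    · simp [resH_zero]
    · exact resH_11 _ _ _ _ hl1 hl2 hmu
  have E2 : ∀ a b : ℕ, (a = Q1 ∨ a = Q1 + 1) → (b = Q2 ∨ b = Q2 + 1) →
      ∑ j : Fin (a + 1) × Fin (b + 1), ((j.2 : ℕ) : ℝ) * v a b j =
        resH lam2 lam1 (lam2 + lam1 * p12) mu b a := by
    intro a b ha hb
    refine expect_eq_resolvent a b lam1 lam2 _ _ mu hmu
      (fun i j => resH lam2 lam1 (lam2 + lam1 * p12) mu j i) (fun _ j => (j : ℝ)) ?_ ?_ ?_ ?_ _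
      (hnorm a b ha hb) (hbal a b ha hb)
    · simp [resH_zero]
    · simp [resH_zero]
    · exact resH_10 _ _ _ _ hs2' hmu
    · intro i j
      have := resH_11 lam2 lam1 (lam2 + lam1 * p12) mu hl2 hl1 hmu j i
      show _ = _
      linarith
  constructor
  · intro Em1
    simp only [Em1]
    rw [E1 _ _ (.inr rfl) (.inr rfl), E1 _ _ (.inr rfl) (.inl rfl), E1 _ _ (.inl rfl) (.inr rfl),
      E1 _ _ (.inl rfl) (.inl rfl)]
    linarith [resH_super lam1 lam2 _ mu hl1 hl2 hmu hs1 Q1 Q2]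
  · intro Em2
    simp only [Em2]
    rw [E2 _ _ (.inr rfl) (.inr rfl), E2 _ _ (.inr rfl) (.inl rfl), E2 _ _ (.inl rfl) (.inr rfl),
      E2 _ _ (.inl rfl) (.inl rfl)]
    linarith [resH_super lam2 lam1 _ mu hl2 hl1 hmu hs2 Q2 Q1]
end

section
/- The expected profit per unit time under exponentially distributed replenishment time is submodular in the order quantities: for all integers Q1, Q2 ≥ 1, if for each pair (a,b) ∈ {(Q1,Q2),(Q1+1,Q2),(Q1,Q2+1),(Q1+1,Q2+1)} the vector v^{(a,b)} is a probability vector on S_{a,b} satisfying v^{(a,b)} · Q⁽²⁾_{a,b} = 0, Em_i(a,b) = Σ_{(j1,j2)∈S_{a,b}} j_i · v^{(a,b)}(j1,j2), and π⁽²⁾(a,b) = μ·[(r1−c1)·a + (r2−c2)·b − (r1+h1)·Em_1(a,b) − (r2+h2)·Em_2(a,b)], then π⁽²⁾(Q1+1,Q2+1) − π⁽²⁾(Q1+1,Q2) − π⁽²⁾(Q1,Q2+1) + π⁽²⁾(Q1,Q2) ≤ 0. -/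
open scoped BigOperators

/-- Discounted value function of the cost given by the stock of product 1. -/
noncomputable def valF (m l1 l2 s1 : ℝ) : ℕ → ℕ → ℝ
  | 0, _ => 0
  | i + 1, 0 => ((i : ℝ) + 1 + s1 * valF m l1 l2 s1 i 0) / (m + s1)
  | i + 1, j + 1 => ((i : ℝ) + 1 + l1 * valF m l1 l2 s1 i (j + 1)
      + l2 * valF m l1 l2 s1 (i + 1) j) / (m + (l1 + l2))

theorem valF_zero (m l1 l2 s1 : ℝ) (j : ℕ) : valF m l1 l2 s1 0 j = 0 := by
  simp [valF]

theorem valF_edge (m l1 l2 s1 : ℝ) (h : 0 < m + s1) (i : ℕ) :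
    (m + s1) * valF m l1 l2 s1 (i + 1) 0 = (i : ℝ) + 1 + s1 * valF m l1 l2 s1 i 0 := by
  rw [valF.eq_2]; field_simp

theorem valF_inner (m l1 l2 s1 : ℝ) (h : 0 < m + (l1 + l2)) (i j : ℕ) :
    (m + (l1 + l2)) * valF m l1 l2 s1 (i + 1) (j + 1) =
      (i : ℝ) + 1 + l1 * valF m l1 l2 s1 i (j + 1) + l2 * valF m l1 l2 s1 (i + 1) j := by
  rw [valF.eq_3]; field_simp

theorem valF_supermod (m l1 l2 s1 : ℝ) (hm : 0 < m) (hl1 : 0 < l1) (hl2 : 0 < l2)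
    (hs : l1 ≤ s1) (i j : ℕ) :
    0 ≤ valF m l1 l2 s1 (i + 1) (j + 1) - valF m l1 l2 s1 (i + 1) j
      - valF m l1 l2 s1 i (j + 1) + valF m l1 l2 s1 i j := by
  have hA : 0 < m + s1 := by linarith
  have hB : 0 < m + (l1 + l2) := by linarith
  have hs0 : 0 ≤ s1 := by linarith
  have hE := valF_edge m l1 l2 s1 hA
  have hI := valF_inner m l1 l2 s1 hB
  have hZ := valF_zero m l1 l2 s1
  generalize valF m l1 l2 s1 = f at *
  have d0 : 0 ≤ f 1 0 := by
    have h := hE 0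
    rw [hZ] at h
    refine nonneg_of_mul_nonneg_right (a := m + s1) ?_ hA
    norm_num at h
    linarith
  have dd : ∀ i, 0 ≤ f (i + 2) 0 - 2 * f (i + 1) 0 + f i 0 := by
    intro i
    induction i with
    | zero =>
      have h1 := hE 0
      have h2 := hE 1
      have h3 := mul_nonneg hs0 d0
      refine nonneg_of_mul_nonneg_right (a := m + s1) ?_ hA
      rw [hZ] at *
      norm_num at *
      nlinarith
    | succ i ih =>
      have h1 := hE i
      have h2 := hE (i + 1)
      have h3 := hE (i + 2)
      have h4 := mul_nonneg hs0 ih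
      refine nonneg_of_mul_nonneg_right (a := m + s1) ?_ hA
      push_cast at *
      nlinarith
  have e0 : ∀ i, (m + (l1 + l2)) * (f (i + 1) 1 - f (i + 1) 0) =
      l1 * (f i 1 - f i 0) + (s1 - l1) * (f (i + 1) 0 - f i 0) := by
    intro i
    have h1 := hE i
    have h2 := hI i 0
    norm_num at *
    linarith
  induction i generalizing j with
  | zero =>
    induction j with
    | zero =>
      have h1 := e0 0
      refine nonneg_of_mul_nonneg_right (a := m + (l1 + l2)) ?_ hB
      have h4 := mul_nonneg (sub_nonneg.2 hs) d0
      simp only [hZ] at *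
      norm_num at *
      linarith
    | succ j ih =>
      have h1 := hI 0 j
      have h2 := hI 0 (j + 1)
      have h4 := mul_nonneg hl2.le ih
      refine nonneg_of_mul_nonneg_right (a := m + (l1 + l2)) ?_ hB
      simp only [hZ] at *
      norm_num at *
      linarith
  | succ i ih =>
    induction j with
    | zero =>
      have h1 := e0 i
      have h2 := e0 (i + 1)
      have h3 := mul_nonneg (sub_nonneg.2 hs) (dd i)
      have h4 := mul_nonneg hl1.le (ih 0)
      refine nonneg_of_mul_nonneg_right (a := m + (l1 + l2)) ?_ hB
      norm_num at *
      linarith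
    | succ j jh =>
      have h1 := hI i j
      have h2 := hI i (j + 1)
      have h3 := hI (i + 1) j
      have h4 := hI (i + 1) (j + 1)
      have h5 := mul_nonneg hl1.le (ih (j + 1))
      have h6 := mul_nonneg hl2.le jh
      refine nonneg_of_mul_nonneg_right (a := m + (l1 + l2)) ?_ hB
      push_cast at *
      linarith

theorem sum_point (a b p q : ℕ) (hp : p ≤ a) (hq : q ≤ b) (c : ℝ) (f : ℕ → ℕ → ℝ) :
    ∑ j : Fin (a + 1) × Fin (b + 1),
      (if (j.1 : ℕ) = p ∧ (j.2 : ℕ) = q then c else 0) * f j.1 j.2 = c * f p q := by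
  rw [Finset.sum_eq_single
    ((⟨p, Nat.lt_succ_of_le hp⟩, ⟨q, Nat.lt_succ_of_le hq⟩) : Fin (a + 1) × Fin (b + 1))]
  · simp
  · rintro ⟨x, y⟩ _ hne
    rw [if_neg, zero_mul]
    rintro ⟨h1, h2⟩
    exact hne (Prod.ext (Fin.ext h1) (Fin.ext h2))
  · simp

theorem sum_gen (a b : ℕ) (l1 l2 s1 s2 m : ℝ) (f h : ℕ → ℕ → ℝ)
    (h00 : m * f 0 0 = h 0 0)
    (hi0 : ∀ i, (m + s1) * f (i + 1) 0 = h (i + 1) 0 + s1 * f i 0)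
    (h0j : ∀ j, (m + s2) * f 0 (j + 1) = h 0 (j + 1) + s2 * f 0 j)
    (hij : ∀ i j, (m + (l1 + l2)) * f (i + 1) (j + 1) =
      h (i + 1) (j + 1) + l1 * f i (j + 1) + l2 * f (i + 1) j)
    (i : Fin (a + 1) × Fin (b + 1)) :
    ∑ j : Fin (a + 1) × Fin (b + 1), invGenRepl a b l1 l2 s1 s2 m i j * f j.1 j.2
      = m * f a b - h i.1 i.2 := by
  have heq : ∀ j k : Fin (a + 1) × Fin (b + 1),
      j = k ↔ (j.1 : ℕ) = (k.1 : ℕ) ∧ (j.2 : ℕ) = (k.2 : ℕ) := by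
    intro j k
    rw [Prod.ext_iff, Fin.ext_iff, Fin.ext_iff]
  have hG : ∑ j : Fin (a + 1) × Fin (b + 1), invGen a b l1 l2 s1 s2 i j * f j.1 j.2
      = m * f i.1 i.2 - h i.1 i.2 := by
    obtain ⟨⟨x, hx⟩, ⟨y, hy⟩⟩ := i
    unfold invGen
    simp only [heq]
    rcases x with _ | x <;> rcases y with _ | y
    · simp [h00]
    · simp only [show ¬ (1 : ℕ) ≤ 0 by omega, false_and, and_false, if_false, Nat.le_add_left,
        and_self, if_true, Nat.add_sub_cancel, add_mul, Finset.sum_add_distrib]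
      rw [sum_point _ _ _ _ (by omega) (by omega), sum_point _ _ _ _ (by omega) (by omega)]
      linarith [h0j y]
    · simp only [show ¬ (1 : ℕ) ≤ 0 by omega, false_and, and_false, if_false, Nat.le_add_left,
        and_self, if_true, Nat.add_sub_cancel, add_mul, Finset.sum_add_distrib]
      rw [sum_point _ _ _ _ (by omega) (by omega), sum_point _ _ _ _ (by omega) (by omega)]
      linarith [hi0 x]
    · simp only [Nat.le_add_left, and_self, if_true, Nat.add_sub_cancel, add_mul,
        Finset.sum_add_distrib]
      rw [sum_point _ _ _ _ (by omega) (by omega), sum_point _ _ _ _ (by omega) (by omega),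
        sum_point _ _ _ _ (by omega) (by omega)]
      linarith [hij x y]
  unfold invGenRepl
  simp only [add_mul, Finset.sum_add_distrib]
  rw [hG]
  by_cases hc : i = (⟨a, Nat.lt_succ_self a⟩, ⟨b, Nat.lt_succ_self b⟩)
  · subst hc
    simp
  · simp only [ne_eq, hc, not_false_eq_true, true_and]
    simp only [heq]
    rw [sum_point _ _ _ _ le_rfl le_rfl,
      sum_point _ _ _ _ (Nat.le_of_lt_succ i.1.2) (Nat.le_of_lt_succ i.2.2)]
    ring

theorem mean_eq (a b : ℕ) (l1 l2 s1 s2 m : ℝ) (f h : ℕ → ℕ → ℝ)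
    (h00 : m * f 0 0 = h 0 0)
    (hi0 : ∀ i, (m + s1) * f (i + 1) 0 = h (i + 1) 0 + s1 * f i 0)
    (h0j : ∀ j, (m + s2) * f 0 (j + 1) = h 0 (j + 1) + s2 * f 0 j)
    (hij : ∀ i j, (m + (l1 + l2)) * f (i + 1) (j + 1) =
      h (i + 1) (j + 1) + l1 * f i (j + 1) + l2 * f (i + 1) j)
    (v : Fin (a + 1) × Fin (b + 1) → ℝ) (hv : ∑ x, v x = 1)
    (hb : ∀ j, ∑ i, v i * invGenRepl a b l1 l2 s1 s2 m i j = 0) :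
    ∑ j : Fin (a + 1) × Fin (b + 1), h j.1 j.2 * v j = m * f a b := by
  have h1 : ∑ j : Fin (a + 1) × Fin (b + 1),
      (∑ i, v i * invGenRepl a b l1 l2 s1 s2 m i j) * f j.1 j.2 = 0 := by
    simp [hb]
  simp only [Finset.sum_mul, mul_assoc] at h1
  rw [Finset.sum_comm] at h1
  simp only [← Finset.mul_sum, sum_gen a b l1 l2 s1 s2 m f h h00 hi0 h0j hij, mul_sub,
    Finset.sum_sub_distrib, ← Finset.sum_mul, hv] at h1
  simp only [mul_comm (h _ _)]
  linarith

/-- **Theorem 4: submodularity of the expected profit per unit time under exponentially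
distributed replenishment time** (eq. (4.25)): if, for each of the four order-quantity
pairs, `v` is a probability vector solving the balance equations `v · Q⁽²⁾ = 0`, and
`π⁽²⁾(a,b) = μ·[(r1−c1)·a + (r2−c2)·b − (r1+h1)·Em₁(a,b) − (r2+h2)·Em₂(a,b)]`, then `π⁽²⁾`
is submodular in the order quantities. -/
theorem profitRandom_submodular (lam1 lam2 mu p12 p21 r1 r2 c1 c2 h1 h2 : ℝ)
    (hl1 : 0 < lam1) (hl2 : 0 < lam2) (hmu : 0 < mu)
    (hp12 : p12 ∈ Set.Icc (0 : ℝ) 1) (hp21 : p21 ∈ Set.Icc (0 : ℝ) 1)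
    (hr1 : 0 ≤ r1) (hr2 : 0 ≤ r2) (hh1 : 0 ≤ h1) (hh2 : 0 ≤ h2)
    (Q1 Q2 : ℕ) (hQ1 : 1 ≤ Q1) (hQ2 : 1 ≤ Q2)
    (v : (a : ℕ) → (b : ℕ) → (Fin (a + 1) × Fin (b + 1) → ℝ))
    (hnonneg : ∀ a b : ℕ, (a = Q1 ∨ a = Q1 + 1) → (b = Q2 ∨ b = Q2 + 1) →
      ∀ x : Fin (a + 1) × Fin (b + 1), 0 ≤ v a b x)
    (hnorm : ∀ a b : ℕ, (a = Q1 ∨ a = Q1 + 1) → (b = Q2 ∨ b = Q2 + 1) →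
      ∑ x : Fin (a + 1) × Fin (b + 1), v a b x = 1)
    (hbal : ∀ a b : ℕ, (a = Q1 ∨ a = Q1 + 1) → (b = Q2 ∨ b = Q2 + 1) →
      ∀ j : Fin (a + 1) × Fin (b + 1),
        ∑ i : Fin (a + 1) × Fin (b + 1),
          v a b i * invGenRepl a b lam1 lam2 (lam1 + lam2 * p21) (lam2 + lam1 * p12) mu i j
          = 0) :
    let Em1 : (a : ℕ) → (b : ℕ) → ℝ := fun a b =>
      ∑ j : Fin (a + 1) × Fin (b + 1), ((j.1 : ℕ) : ℝ) * v a b j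
    let Em2 : (a : ℕ) → (b : ℕ) → ℝ := fun a b =>
      ∑ j : Fin (a + 1) × Fin (b + 1), ((j.2 : ℕ) : ℝ) * v a b j
    let prof : (a : ℕ) → (b : ℕ) → ℝ := fun a b =>
      mu * ((r1 - c1) * (a : ℝ) + (r2 - c2) * (b : ℝ) -
        (r1 + h1) * Em1 a b - (r2 + h2) * Em2 a b)
    prof (Q1 + 1) (Q2 + 1) - prof (Q1 + 1) Q2 - prof Q1 (Q2 + 1) + prof Q1 Q2 ≤ 0 := by
  have hs1 : lam1 ≤ lam1 + lam2 * p21 := by nlinarith [hp21.1]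
  have hs2 : lam2 ≤ lam2 + lam1 * p12 := by nlinarith [hp12.1]
  generalize lam1 + lam2 * p21 = s1 at *
  generalize lam2 + lam1 * p12 = s2 at *
  intro Em1 Em2 prof
  have hE1 : ∀ a b : ℕ, (a = Q1 ∨ a = Q1 + 1) → (b = Q2 ∨ b = Q2 + 1) →
      Em1 a b = mu * valF mu lam1 lam2 s1 a b := by
    intro a b ha hb
    refine mean_eq a b lam1 lam2 s1 s2 mu (valF mu lam1 lam2 s1) (fun i _ => (i : ℝ))
      ?_ ?_ ?_ ?_ (v a b) (hnorm a b ha hb) (hbal a b ha hb)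
    · simp [valF_zero]
    · intro i
      rw [valF_edge _ _ _ _ (by linarith)]
      push_cast; ring
    · intro j
      simp [valF_zero]
    · intro i j
      rw [valF_inner _ _ _ _ (by linarith)]
      push_cast; ring
  have hE2 : ∀ a b : ℕ, (a = Q1 ∨ a = Q1 + 1) → (b = Q2 ∨ b = Q2 + 1) →
      Em2 a b = mu * valF mu lam2 lam1 s2 b a := by
    intro a b ha hb
    refine mean_eq a b lam1 lam2 s1 s2 mu (fun i j => valF mu lam2 lam1 s2 j i)
      (fun _ j => (j : ℝ)) ?_ ?_ ?_ ?_ (v a b) (hnorm a b ha hb) (hbal a b ha hb)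
    · simp [valF_zero]
    · intro i
      simp [valF_zero]
    · intro j
      rw [valF_edge _ _ _ _ (by linarith)]
      push_cast; ring
    · intro i j
      rw [add_comm lam1 lam2, valF_inner _ _ _ _ (by linarith)]
      push_cast; ring
  have k1 := valF_supermod mu lam1 lam2 s1 hmu hl1 hl2 hs1 Q1 Q2
  have k2 := valF_supermod mu lam2 lam1 s2 hmu hl2 hl1 hs2 Q2 Q1
  have k3 := mul_nonneg (mul_nonneg hmu.le hmu.le)
    (add_nonneg (mul_nonneg (add_nonneg hr1 hh1) k1) (mul_nonneg (add_nonneg hr2 hh2) k2))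
  simp only [prof]
  rw [hE1 _ _ (Or.inr rfl) (Or.inr rfl), hE1 _ _ (Or.inr rfl) (Or.inl rfl),
    hE1 _ _ (Or.inl rfl) (Or.inr rfl), hE1 _ _ (Or.inl rfl) (Or.inl rfl),
    hE2 _ _ (Or.inr rfl) (Or.inr rfl), hE2 _ _ (Or.inr rfl) (Or.inl rfl),
    hE2 _ _ (Or.inl rfl) (Or.inr rfl), hE2 _ _ (Or.inl rfl) (Or.inl rfl)]
  push_cast
  linarith
end

section
/- Monotonicity of the optimal second-product order quantity: let f : ℕ×ℕ → ℝ satisfy f(a+1,b+1) − f(a+1,b) − f(a,b+1) + f(a,b) ≤ 0 for all natural numbers a, b, let a1, a2 > 0 and C ≥ 0 be reals, and for each natural number q with a1·q ≤ C define m(q) = ⌊(C − a1·q)/a2⌋ and Q2*(q) = max{ b ∈ {0,…,m(q)} : f(q,b) = max_{b' ∈ {0,…,m(q)}} f(q,b') } (the largest maximizer of f(q,·) over the feasible set). Then Q2* is decreasing: for every natural number q with a1·(q+1) ≤ C, Q2*(q+1) ≤ Q2*(q). -/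
/-- **Lemma 1: monotonicity of the optimal second-product order quantity.**
Let `f : ℕ × ℕ → ℝ` be submodular, let `a1, a2 > 0` and `C ≥ 0` be reals, and for each `q`
with `a1·q ≤ C` let `m q = ⌊(C − a1·q)/a2⌋` and let `Q2star q` be the largest maximizer of
`f(q, ·)` over `{0, …, m q}`. Then `Q2star` is decreasing: `Q2star (q+1) ≤ Q2star q`
whenever `a1·(q+1) ≤ C`. -/
theorem optimal_Q2_decreasing (f : ℕ × ℕ → ℝ)
    (hsub : ∀ a b : ℕ, f (a + 1, b + 1) - f (a + 1, b) - f (a, b + 1) + f (a, b) ≤ 0)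
    (a1 a2 C : ℝ) (ha1 : 0 < a1) (ha2 : 0 < a2) (hC : 0 ≤ C)
    (m : ℕ → ℕ) (hm : ∀ q : ℕ, a1 * (q : ℝ) ≤ C → m q = ⌊(C - a1 * (q : ℝ)) / a2⌋₊)
    (Q2star : ℕ → ℕ)
    (hfeas : ∀ q : ℕ, a1 * (q : ℝ) ≤ C → Q2star q ≤ m q)
    (hmax : ∀ q : ℕ, a1 * (q : ℝ) ≤ C → ∀ b : ℕ, b ≤ m q → f (q, b) ≤ f (q, Q2star q))
    (hlargest : ∀ q : ℕ, a1 * (q : ℝ) ≤ C → ∀ b : ℕ, b ≤ m q →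
      f (q, b) = f (q, Q2star q) → b ≤ Q2star q) :
    ∀ q : ℕ, a1 * ((q : ℝ) + 1) ≤ C → Q2star (q + 1) ≤ Q2star q := by
  intro q hq1
  have hq1' : a1 * ((q + 1 : ℕ) : ℝ) ≤ C := by push_cast; exact hq1
  have hq : a1 * (q : ℝ) ≤ C := by nlinarith
  have hmm : m (q + 1) ≤ m q := by
    rw [hm q hq, hm (q + 1) hq1']
    apply Nat.floor_le_floor
    apply div_le_div_of_nonneg_right _ ha2.le
    push_cast
    nlinarith
  by_contra! hlt
  have hanti : Antitone (fun b : ℕ => f (q + 1, b) - f (q, b)) := by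
    apply antitone_nat_of_succ_le
    intro b
    have := hsub q b
    linarith
  have h1 := hanti hlt.le
  simp only at h1
  have hy := hfeas (q + 1) hq1'
  have h2 := hmax q hq _ (hy.trans hmm)
  have h3 := hmax (q + 1) hq1' _ (hlt.le.trans hy)
  have h4 := hlargest q hq _ (hy.trans hmm) (by linarith)
  omega
end
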